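/- Let P be a simplicial d-polytope. Then its h-numbers are nondecreasing up to the middle: 1 = h_0(P) ≤ h_1(P) ≤ h_2(P) ≤ ⋯ ≤ h_{⌊d/2⌋}(P). -/

import Mathlib

open Set

/-- A polytope: the convex hull of a finite set of points. -/
def IsPolytope {E : Type*} [AddCommGroup E] [Module ℝ E] (P : Set E) : Prop :=
  ∃ V : Finset E, P = convexHull ℝ (V : Set E)

/-- A (nonempty, proper) exposed face of `P`. -/
def IsProperFace {E : Type*} [AddCommGroup E] [Module ℝ E] [TopologicalSpace E]
    (P F : Set E) : Prop :=
  F.Nonempty ∧ F ≠ P ∧ IsExposed ℝ P F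

/-- A polytope is simplicial if the vertices (extreme points) of each proper face are
affinely independent. -/
def IsSimplicial {d : ℕ} (P : Set (Fin d → ℝ)) : Prop :=
  ∀ F : Set (Fin d → ℝ), IsProperFace P F →
    AffineIndependent ℝ (fun x : F.extremePoints ℝ => (x : Fin d → ℝ))

/-- The number of `j`-dimensional proper faces of `P`. -/
noncomputable def faceCount {d : ℕ} (P : Set (Fin d → ℝ)) (j : ℕ) : ℕ :=
  Set.ncard {F : Set (Fin d → ℝ) |
    IsProperFace P F ∧ Module.finrank ℝ (affineSpan ℝ F).direction = j}

/-- `f_{j-1}(P)` with the convention `f_{-1} = 1`. -/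
noncomputable def fm {d : ℕ} (P : Set (Fin d → ℝ)) (j : ℕ) : ℤ :=
  if j = 0 then 1 else (faceCount P (j - 1) : ℤ)

/-- The `h`-numbers of a simplicial `d`-polytope:
`h_i = ∑_{j=0}^{i} (-1)^{i-j} C(d-j, i-j) f_{j-1}`. -/
noncomputable def hP {d : ℕ} (P : Set (Fin d → ℝ)) (i : ℕ) : ℤ :=
  ∑ j ∈ Finset.range (i + 1),
    (-1 : ℤ) ^ (i - j) * ((d - j).choose (i - j)) * fm P j

/-- A derivation of a domain extends to its field of fractions. -/
theorem exists_derivation_extending {R K : Type*} [CommRing R] [Field K] [Algebra R K]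
    [IsFractionRing R K] (δ : R →+ R) (hδ : ∀ x y, δ (x * y) = x * δ y + y * δ x) :
    ∃ D : Derivation ℤ K K, ∀ r : R, D (algebraMap R K r) = algebraMap R K (δ r) := by
  have h1 : δ 1 = 0 := by simpa using hδ 1 1
  let φ : R →+* DualNumber K :=
    { toFun := fun r => TrivSqZeroExt.inl (algebraMap R K r) +
        TrivSqZeroExt.inr (algebraMap R K (δ r))
      map_one' := by ext <;> simp [h1]
      map_zero' := by ext <;> simp
      map_add' := fun x y => by ext <;> simp [-algebraMap_smul]
      map_mul' := fun x y => by
        ext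
        · simp
        · simp only [map_mul, hδ, map_add, TrivSqZeroExt.snd_add, TrivSqZeroExt.snd_inl,
            TrivSqZeroExt.snd_inr, TrivSqZeroExt.snd_mul, TrivSqZeroExt.fst_add,
            TrivSqZeroExt.fst_inl, TrivSqZeroExt.fst_inr, zero_add, add_zero, smul_eq_mul,
            op_smul_eq_mul]
          ring }
  have hφ1 : ∀ r, (φ r).fst = algebraMap R K r := fun r => by simp [φ]
  have hφ2 : ∀ r, (φ r).snd = algebraMap R K (δ r) := fun r => by simp [φ, -algebraMap_smul]
  have hφ : ∀ y : nonZeroDivisors R, IsUnit (φ y) := fun y => by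
    rw [TrivSqZeroExt.isUnit_iff_isUnit_fst, hφ1]
    exact IsLocalization.map_units K y
  let Φ : K →+* DualNumber K := IsLocalization.lift hφ
  have hΦ : ∀ r, Φ (algebraMap R K r) = φ r := fun r => IsLocalization.lift_eq hφ r
  have hfst : ∀ x, (Φ x).fst = x := by
    have : (TrivSqZeroExt.fstHom ℤ K K).toRingHom.comp Φ = RingHom.id K := by
      apply IsLocalization.ringHom_ext (nonZeroDivisors R)
      ext r
      simp [hΦ, hφ1]
    intro x
    exact congrArg (fun f : K →+* K => f x) this
  refine ⟨Derivation.mk' (AddMonoidHom.toIntLinearMap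
    { toFun := fun x => (Φ x).snd
      map_zero' := by simp
      map_add' := by simp }) ?_, ?_⟩
  · intro x y
    simp [hfst]
    ring
  · intro r
    simp [hΦ, hφ2, -algebraMap_smul]

/-- The fraction field of a polynomial ring carries commuting partial derivatives. -/
theorem exists_partial_derivations {σ k K : Type*} [DecidableEq σ] [Field k] [Field K]
    [Algebra (MvPolynomial σ k) K] [IsFractionRing (MvPolynomial σ k) K] :
    ∃ D : σ → Derivation ℤ K K,
      (∀ s t, D s (algebraMap (MvPolynomial σ k) _ (MvPolynomial.X t)) =
        if s = t then 1 else 0) ∧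
      ∀ s t x, D s (D t x) = D t (D s x) := by
  have h := fun s : σ => exists_derivation_extending (R := MvPolynomial σ k) (K := K)
    (MvPolynomial.pderiv (R := k) s).toLinearMap.toAddMonoidHom
    (fun x y => by simp [Derivation.leibniz])
  choose D hD using h
  replace hD : ∀ s r, D s (algebraMap (MvPolynomial σ k) K r) =
    algebraMap (MvPolynomial σ k) K (MvPolynomial.pderiv s r) := hD
  have hX : ∀ s t, D s (algebraMap (MvPolynomial σ k) _ (MvPolynomial.X t)) =
      if s = t then 1 else 0 := by
    intro s t
    rw [hD]
    simp only [MvPolynomial.pderiv_X, Pi.single_apply]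
    split_ifs <;> simp_all
  refine ⟨D, hX, fun s t x => ?_⟩
  have hR : ∀ r, ⁅D s, D t⁆ (algebraMap (MvPolynomial σ k) _ r) = 0 := by
    intro r
    rw [Derivation.commutator_apply, hD, hD, hD, hD, sub_eq_zero]
    congr 1
    have : ⁅MvPolynomial.pderiv (R := k) s, MvPolynomial.pderiv (R := k) t⁆ = 0 := by
      apply MvPolynomial.derivation_ext
      intro i
      simp only [Derivation.commutator_apply, MvPolynomial.pderiv_X, Pi.single_apply]
      split_ifs <;> simp
    have := congrArg (fun d => d r) this
    simpa [Derivation.commutator_apply, sub_eq_zero] using this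
  have h0 : ⁅D s, D t⁆ x = 0 := by
    obtain ⟨a, b, hb, rfl⟩ := IsFractionRing.div_surjective (A := MvPolynomial σ k) x
    rw [Derivation.leibniz_div, hR, hR]
    simp
  rwa [Derivation.commutator_apply, sub_eq_zero] at h0

/-- A family of generic column vectors `a · v`, a generic vector `z`, generic scalars `b v`, and
the corresponding partial derivatives. -/
structure GenericFrame (n : ℕ) (V K : Type*) [DecidableEq V] [Field K] where
  a : Fin n → V → K
  z : Fin n → K
  b : V → K
  D : Fin n → V → Derivation ℤ K K
  Z : Fin n → Derivation ℤ K K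
  B : V → Derivation ℤ K K
  D_a : ∀ r i q j, D r i (a q j) = if r = q ∧ i = j then 1 else 0
  D_z : ∀ r i q, D r i (z q) = 0
  Z_a : ∀ r q j, Z r (a q j) = 0
  Z_z : ∀ r q, Z r (z q) = if r = q then 1 else 0
  B_a : ∀ v q j, B v (a q j) = 0
  B_z : ∀ v q, B v (z q) = 0
  B_b : ∀ v w, B v (b w) = if v = w then 1 else 0
  D_Z_comm : ∀ r i q x, D r i (Z q x) = Z q (D r i x)
  Z_comm : ∀ r q x, Z r (Z q x) = Z q (Z r x)
  det_ne_zero : ∀ c : Fin n → V, Function.Injective c →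
    (Matrix.of fun r s => a r (c s)).det ≠ 0

theorem exists_genericFrame.{u} (n : ℕ) (V : Type u) [DecidableEq V] :
    ∃ (K : Type u) (_ : Field K) (_ : CharP K 2), Nonempty (GenericFrame n V K) := by
  let σ := (Fin n × V) ⊕ (Fin n ⊕ V)
  let R := MvPolynomial σ (ZMod 2)
  refine ⟨FractionRing R, inferInstance,
    charP_of_injective_algebraMap (IsFractionRing.injective R (FractionRing R)) 2, ?_⟩
  obtain ⟨D, hD, hcomm⟩ := exists_partial_derivations (σ := σ) (k := ZMod 2) (K := FractionRing R)
  refine ⟨⟨fun r v => algebraMap R _ (MvPolynomial.X (Sum.inl (r, v))),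
    fun r => algebraMap R _ (MvPolynomial.X (Sum.inr (Sum.inl r))),
    fun v => algebraMap R _ (MvPolynomial.X (Sum.inr (Sum.inr v))),
    fun r v => D (Sum.inl (r, v)), fun r => D (Sum.inr (Sum.inl r)),
    fun v => D (Sum.inr (Sum.inr v)), ?_, ?_, ?_, ?_, ?_, ?_, ?_, ?_, ?_, ?_⟩⟩
  · intros; simp [R, σ, hD]
  · intros; simp [R, σ, hD]
  · intros; simp [R, σ, hD]
  · intros; simp [R, σ, hD]
  · intros; simp [R, σ, hD]
  · intros; simp [R, σ, hD]
  · intros; simp [R, σ, hD]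
  · intros; exact hcomm _ _ _
  · intros; exact hcomm _ _ _
  · intro c hc
    have hinj : Function.Injective (fun p : Fin n × Fin n => (Sum.inl (p.1, c p.2) : σ)) := by
      rintro ⟨r, s⟩ ⟨r', s'⟩ h
      simp only [Sum.inl.injEq, Prod.mk.injEq] at h
      exact Prod.ext h.1 (hc h.2)
    let f : MvPolynomial (Fin n × Fin n) (ZMod 2) →+* FractionRing R :=
      (algebraMap R _).comp (MvPolynomial.rename (R := ZMod 2)
        (fun p : Fin n × Fin n => (Sum.inl (p.1, c p.2) : σ))).toRingHom
    have hf : Function.Injective f :=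
      (IsFractionRing.injective R (FractionRing R)).comp (MvPolynomial.rename_injective _ hinj)
    have : (Matrix.of fun r s => algebraMap R (FractionRing R)
        (MvPolynomial.X (Sum.inl (r, c s)))) =
        f.mapMatrix (Matrix.mvPolynomialX (Fin n) (Fin n) (ZMod 2)) := by
      ext r s
      simp [f, Matrix.mvPolynomialX, R]
    rw [this, ← RingHom.map_det, Ne, map_eq_zero_iff f hf]
    exact Matrix.det_mvPolynomialX_ne_zero _ _

section Derivations

variable {K : Type*} [Field K]

theorem Derivation.map_prod_eq_zero {ι : Type*} (δ : Derivation ℤ K K) (s : Finset ι)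
    (f : ι → K) (h : ∀ i ∈ s, δ (f i) = 0) : δ (∏ i ∈ s, f i) = 0 := by
  classical
  induction s using Finset.induction_on with
  | empty => simp
  | insert i s hi ih =>
    rw [Finset.prod_insert hi, Derivation.leibniz, h i (Finset.mem_insert_self _ _),
      ih fun j hj => h j (Finset.mem_insert_of_mem hj)]
    simp

theorem Derivation.map_det_eq_zero {m : Type*} [Fintype m] [DecidableEq m]
    (δ : Derivation ℤ K K) (M : Matrix m m K) (h : ∀ i j, δ (M i j) = 0) : δ M.det = 0 := by
  rw [Matrix.det_apply', map_sum]
  refine Finset.sum_eq_zero fun σ _ => ?_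
  rw [Derivation.leibniz, Derivation.map_prod_eq_zero δ _ _ fun i _ => h _ _]
  simp

theorem Derivation.map_inv_apply_eq_zero {m : Type*} [Fintype m] [DecidableEq m]
    (δ : Derivation ℤ K K) (M : Matrix m m K) (hM : M.det ≠ 0) (h : ∀ i j, δ (M i j) = 0)
    (s r : m) : δ (M⁻¹ s r) = 0 := by
  have hu : IsUnit M.det := isUnit_iff_ne_zero.mpr hM
  have h1 : M.mulVec (fun t => δ (M⁻¹ t r)) = 0 := by
    ext q
    have := congrArg (fun N => δ (N q r)) (M.mul_nonsing_inv hu)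
    simp only [Matrix.mul_apply, map_sum, Derivation.leibniz, smul_eq_mul, h, mul_zero,
      add_zero] at this
    simp only [Matrix.mulVec, dotProduct, Pi.zero_apply]
    rw [this, Matrix.one_apply]
    split_ifs <;> simp
  exact congrFun (Matrix.eq_zero_of_mulVec_eq_zero hM h1) s

theorem Derivation.map_sq_mul [CharP K 2] (δ : Derivation ℤ K K) (x y : K) :
    δ (x ^ 2 * y) = x ^ 2 * δ y := by
  simp [Derivation.leibniz, Derivation.leibniz_pow, CharTwo.two_eq_zero]

end Derivations

namespace GenericFrame

variable {n : ℕ} {V K : Type*} [DecidableEq V] [Field K] (G : GenericFrame n V K)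
  (c : Fin n → V)

/-- The square matrix with columns `a · (c s)`. -/
def mat : Matrix (Fin n) (Fin n) K := Matrix.of fun r s => G.a r (c s)

/-- The coordinates of `z` in the basis of columns `a · (c s)`, extended by zero to `V`. -/
noncomputable def w (v : V) : K := ∑ s, if c s = v then ((G.mat c)⁻¹.mulVec G.z) s else 0

/-- The basis dual to the columns `a · (c s)`, extended by zero to `V`. -/
noncomputable def dual (v : V) (r : Fin n) : K := ∑ s, if c s = v then (G.mat c)⁻¹ s r else 0

variable {c}

theorem det_mat_ne_zero (hc : Function.Injective c) : (G.mat c).det ≠ 0 := G.det_ne_zero c hc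

theorem isUnit_det_mat (hc : Function.Injective c) : IsUnit (G.mat c).det :=
  isUnit_iff_ne_zero.mpr (G.det_mat_ne_zero hc)

theorem w_apply (hc : Function.Injective c) (s : Fin n) :
    G.w c (c s) = ((G.mat c)⁻¹.mulVec G.z) s := by
  simp [w, hc.eq_iff]

theorem dual_apply (hc : Function.Injective c) (s r : Fin n) :
    G.dual c (c s) r = (G.mat c)⁻¹ s r := by
  simp [dual, hc.eq_iff]

theorem w_eq_zero {v : V} (hv : v ∉ Set.range c) : G.w c v = 0 := by
  refine Finset.sum_eq_zero fun s _ => if_neg fun h => hv ⟨s, h⟩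

theorem dual_eq_zero {v : V} (hv : v ∉ Set.range c) (r : Fin n) : G.dual c v r = 0 := by
  refine Finset.sum_eq_zero fun s _ => if_neg fun h => hv ⟨s, h⟩

theorem sum_a_mul_w (hc : Function.Injective c) (r : Fin n) :
    ∑ s, G.a r (c s) * G.w c (c s) = G.z r := by
  have := congrFun (Matrix.mulVec_mulVec G.z (G.mat c) (G.mat c)⁻¹) r
  rw [Matrix.mul_nonsing_inv _ (G.isUnit_det_mat hc), Matrix.one_mulVec] at this
  rw [← this]
  simp [Matrix.mulVec, dotProduct, mat, G.w_apply hc]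

theorem sum_dual_mul_a (hc : Function.Injective c) (v : V) (s : Fin n) :
    ∑ r, G.dual c v r * G.a r (c s) = if v = c s then 1 else 0 := by
  by_cases hv : v ∈ Set.range c
  · obtain ⟨t, rfl⟩ := hv
    have := congrFun (congrFun (Matrix.nonsing_inv_mul _ (G.isUnit_det_mat hc)) t) s
    rw [Matrix.mul_apply, Matrix.one_apply] at this
    simp only [G.dual_apply hc, hc.eq_iff]
    exact this
  · rw [if_neg fun h => hv ⟨s, h.symm⟩]
    exact Finset.sum_eq_zero fun r _ => by rw [G.dual_eq_zero hv, zero_mul]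

theorem sum_dual_mul_z (hc : Function.Injective c) (v : V) :
    ∑ r, G.dual c v r * G.z r = G.w c v := by
  by_cases hv : v ∈ Set.range c
  · obtain ⟨t, rfl⟩ := hv
    simp [G.dual_apply hc, G.w_apply hc, Matrix.mulVec, dotProduct]
  · rw [G.w_eq_zero hv]
    exact Finset.sum_eq_zero fun r _ => by rw [G.dual_eq_zero hv, zero_mul]

theorem sum_univ_a_mul_w [Fintype V] (hc : Function.Injective c) (r : Fin n) :
    ∑ v, G.a r v * G.w c v = G.z r := by
  rw [← G.sum_a_mul_w hc r]
  symm
  apply Finset.sum_of_injOn c hc.injOn (by simp)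
  · intro v _ hv
    rw [G.w_eq_zero (by simpa using hv), mul_zero]
  · simp

theorem Z_dual (hc : Function.Injective c) (q r : Fin n) (v : V) : G.Z q (G.dual c v r) = 0 := by
  by_cases hv : v ∈ Set.range c
  · obtain ⟨t, rfl⟩ := hv
    rw [G.dual_apply hc]
    exact Derivation.map_inv_apply_eq_zero _ _ (G.det_mat_ne_zero hc)
      (fun i j => G.Z_a _ _ _) _ _
  · rw [G.dual_eq_zero hv, map_zero]

theorem Z_det (q : Fin n) : G.Z q (G.mat c).det = 0 :=
  Derivation.map_det_eq_zero _ _ fun _ _ => G.Z_a _ _ _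

theorem B_det (v : V) : G.B v (G.mat c).det = 0 :=
  Derivation.map_det_eq_zero _ _ fun _ _ => G.B_a _ _ _

theorem B_w (hc : Function.Injective c) (v u : V) : G.B v (G.w c u) = 0 := by
  by_cases hu : u ∈ Set.range c
  · obtain ⟨t, rfl⟩ := hu
    rw [G.w_apply hc]
    simp only [Matrix.mulVec, dotProduct, map_sum, Derivation.leibniz]
    refine Finset.sum_eq_zero fun r _ => ?_
    rw [G.B_z, Derivation.map_inv_apply_eq_zero _ _ (G.det_mat_ne_zero hc)
      (fun i j => G.B_a _ _ _)]
    simp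
  · rw [G.w_eq_zero hu, map_zero]

theorem Z_w (hc : Function.Injective c) (r : Fin n) (v : V) :
    G.Z r (G.w c v) = G.dual c v r := by
  rw [← G.sum_dual_mul_z hc, map_sum]
  simp [Derivation.leibniz, G.Z_dual hc, G.Z_z]

theorem w_ne_zero (hc : Function.Injective c) (s : Fin n) : G.w c (c s) ≠ 0 := by
  intro h
  have h1 : ∀ r, G.dual c (c s) r = 0 := fun r => by
    rw [← G.Z_w hc, h, map_zero]
  have h2 := G.sum_dual_mul_a hc (c s) s
  simp [h1] at h2

theorem D_w [CharP K 2] (hc : Function.Injective c) (r : Fin n) (i v : V) :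
    G.D r i (G.w c v) = G.w c i * G.dual c v r := by
  by_cases hv : v ∈ Set.range c
  · obtain ⟨t, rfl⟩ := hv
    have h1 : (G.mat c).mulVec (fun s => G.D r i (G.w c (c s)) + G.w c i * G.dual c (c s) r)
        = 0 := by
      ext q
      have h2 := congrArg (G.D r i) (G.sum_a_mul_w hc q)
      simp only [map_sum, Derivation.leibniz, G.D_a, G.D_z, smul_eq_mul,
        Finset.sum_add_distrib] at h2
      have h3 : ∑ s, G.w c (c s) * (if r = q ∧ i = c s then (1 : K) else 0) =
          if r = q then G.w c i else 0 := by
        by_cases hrq : r = q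
        · simp only [hrq, true_and, if_true]
          by_cases hi : i ∈ Set.range c
          · obtain ⟨u, rfl⟩ := hi
            simp [hc.eq_iff]
          · rw [G.w_eq_zero hi]
            refine Finset.sum_eq_zero fun s _ => ?_
            rw [if_neg fun h => hi ⟨s, h.symm⟩, mul_zero]
        · simp [hrq]
      have h4 : ∑ s, G.a q (c s) * G.dual c (c s) r = if r = q then 1 else 0 := by
        have := congrFun (congrFun (Matrix.mul_nonsing_inv _ (G.isUnit_det_mat hc)) q) r
        rw [Matrix.mul_apply, Matrix.one_apply] at this
        simp only [G.dual_apply hc, eq_comm (a := r)]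
        exact this
      rw [h3] at h2
      simp only [Matrix.mulVec, dotProduct, mat, Matrix.of_apply, mul_add,
        Finset.sum_add_distrib, Pi.zero_apply]
      rw [← h2]
      congr 1
      rw [← mul_one (G.w c i), ← mul_ite_zero, ← h4, Finset.mul_sum]
      refine Finset.sum_congr rfl fun s _ => by ring
    have h5 := congrFun (Matrix.eq_zero_of_mulVec_eq_zero (G.det_mat_ne_zero hc) h1) t
    exact CharTwo.add_eq_zero.mp h5
  · rw [G.w_eq_zero hv, G.dual_eq_zero hv, map_zero, mul_zero]

theorem D_det (hc : Function.Injective c) (r : Fin n) (i : V) :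
    G.D r i (G.mat c).det = (G.mat c).det * G.dual c i r := by
  have hadj : ∀ s, (G.mat c).adjugate s r = (G.mat c).det * (G.mat c)⁻¹ s r := by
    intro s
    rw [Matrix.inv_def, Matrix.smul_apply, smul_eq_mul, Ring.inverse_eq_inv',
      mul_inv_cancel_left₀ (G.det_mat_ne_zero hc)]
  have h0 : ∀ s, G.D r i ((G.mat c).adjugate s r) = 0 := by
    intro s
    rw [Matrix.adjugate_apply]
    apply Derivation.map_det_eq_zero
    intro p q
    rw [Matrix.updateRow_apply]
    split_ifs with h
    · rw [Pi.single_apply]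
      split_ifs <;> simp
    · simp [mat, G.D_a, Ne.symm h]
  have hD : ∀ s, G.D r i (G.mat c r s) = if i = c s then 1 else 0 := fun s => by
    simp [mat, G.D_a]
  conv_lhs => rw [Matrix.det_eq_sum_mul_adjugate_row _ r]
  simp only [map_sum, Derivation.leibniz, h0, smul_eq_mul, hD]
  rw [dual, Finset.mul_sum]
  refine Finset.sum_congr rfl fun s _ => ?_
  simp only [eq_comm (a := i), mul_ite, mul_zero, mul_one, zero_add, hadj]

end GenericFrame

section IteratedDerivation

variable {n : ℕ} {K : Type*} [Field K] (δ : Fin n → Derivation ℤ K K)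

/-- The composition of the derivations indexed by the entries of a list. -/
noncomputable def iterDerivation (l : List (Fin n)) : Module.End ℤ K :=
  (l.map fun r => (δ r : Module.End ℤ K)).prod

theorem iterDerivation_nil (x : K) : iterDerivation δ [] x = x := rfl

theorem iterDerivation_cons (r : Fin n) (l : List (Fin n)) (x : K) :
    iterDerivation δ (r :: l) x = δ r (iterDerivation δ l x) := by
  simp [iterDerivation]

theorem iterDerivation_mul_of_eq_zero (l : List (Fin n)) {x : K} (hx : ∀ r ∈ l, δ r x = 0)
    (y : K) : iterDerivation δ l (x * y) = x * iterDerivation δ l y := by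
  induction l with
  | nil => rfl
  | cons r l ih =>
    rw [iterDerivation_cons, iterDerivation_cons, ih fun q hq => hx q (List.mem_cons_of_mem _ hq),
      Derivation.leibniz, hx r List.mem_cons_self]
    simp

theorem iterDerivation_sq_mul [CharP K 2] (l : List (Fin n)) (x y : K) :
    iterDerivation δ l (x ^ 2 * y) = x ^ 2 * iterDerivation δ l y :=
  iterDerivation_mul_of_eq_zero δ l
    (fun r _ => by simpa using (δ r).map_sq_mul x 1) y

theorem iterDerivation_comm (l : List (Fin n)) (ε : Derivation ℤ K K)
    (h : ∀ r x, ε (δ r x) = δ r (ε x)) (x : K) :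
    ε (iterDerivation δ l x) = iterDerivation δ l (ε x) := by
  induction l with
  | nil => rfl
  | cons r l ih => rw [iterDerivation_cons, iterDerivation_cons, h, ih]

end IteratedDerivation

theorem Matrix.det_eq_sum_prod_of_charTwo {m R : Type*} [Fintype m] [DecidableEq m] [CommRing R]
    [CharP R 2] (M : Matrix m m R) : M.det = ∑ σ : Equiv.Perm m, ∏ i, M i (σ i) := by
  rw [← Matrix.det_transpose, Matrix.det_apply']
  refine Finset.sum_congr rfl fun σ _ => ?_
  rcases Int.units_eq_one_or (Equiv.Perm.sign σ) with h | h <;>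
    simp [h, CharTwo.neg_eq]

namespace GenericFrame

variable {n : ℕ} {V K : Type*} [DecidableEq V] [Field K] (G : GenericFrame n V K)
  {c : Fin n → V}

theorem iterDerivation_Z_eq_zero (l : List (Fin n)) {r : Fin n} (hr : r ∈ l) {x : K}
    (hx : G.Z r x = 0) : iterDerivation G.Z l x = 0 := by
  induction l with
  | nil => simp at hr
  | cons q l ih =>
    rw [iterDerivation_cons]
    rcases List.mem_cons.mp hr with rfl | h
    · rw [iterDerivation_comm _ _ _ fun q x => G.Z_comm _ q x, hx, map_zero]
    · rw [ih h, map_zero]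

theorem iterDerivation_Z_prod_z (l : List (Fin n)) (hl : l.Nodup) :
    iterDerivation G.Z l (l.map G.z).prod = 1 := by
  induction l with
  | nil => simp [iterDerivation_nil]
  | cons r l ih =>
    rw [List.nodup_cons] at hl
    rw [iterDerivation_cons, List.map_cons, List.prod_cons,
      iterDerivation_mul_of_eq_zero, ih hl.2, mul_one, G.Z_z, if_pos rfl]
    intro q hq
    rw [G.Z_z, if_neg]
    rintro rfl
    exact hl.1 hq

theorem iterDerivation_Z_prod_w [CharP K 2] (hc : Function.Injective c) :
    iterDerivation G.Z (List.finRange n) (∏ s, G.w c (c s)) = (G.mat c).det⁻¹ := by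
  have h1 : ∏ s, G.w c (c s) = ∑ ρ : Fin n → Fin n,
      (∏ s, G.dual c (c s) (ρ s)) * ∏ s, G.z (ρ s) := by
    simp_rw [← G.sum_dual_mul_z hc, Fintype.prod_sum, Finset.prod_mul_distrib]
  have h2 : ∀ ρ : Fin n → Fin n, iterDerivation G.Z (List.finRange n)
      ((∏ s, G.dual c (c s) (ρ s)) * ∏ s, G.z (ρ s)) =
      (∏ s, G.dual c (c s) (ρ s)) * iterDerivation G.Z (List.finRange n) (∏ s, G.z (ρ s)) := by
    intro ρ
    apply iterDerivation_mul_of_eq_zero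
    intro r _
    exact Derivation.map_prod_eq_zero _ _ _ fun s _ => G.Z_dual hc _ _ _
  rw [h1, map_sum, Finset.sum_congr rfl fun ρ _ => h2 ρ, ← Ring.inverse_eq_inv',
    ← Matrix.det_nonsing_inv, Matrix.det_eq_sum_prod_of_charTwo]
  symm
  apply Finset.sum_of_injOn (fun σ : Equiv.Perm (Fin n) => (σ : Fin n → Fin n))
    DFunLike.coe_injective.injOn (by simp)
  · intro ρ _ hρ
    have hs : ¬ Function.Surjective ρ := fun h => hρ
      ⟨Equiv.ofBijective ρ ⟨Finite.injective_iff_surjective.mpr h, h⟩, by simp, rfl⟩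
    rw [Function.Surjective] at hs
    push Not at hs
    obtain ⟨q, hq⟩ := hs
    rw [G.iterDerivation_Z_eq_zero _ (List.mem_finRange q), mul_zero]
    exact Derivation.map_prod_eq_zero _ _ _ fun s _ => by
      rw [G.Z_z, if_neg fun h => hq s h.symm]
  · intro σ _
    rw [Equiv.prod_comp σ G.z]
    have := G.iterDerivation_Z_prod_z _ (List.nodup_finRange n)
    rw [← List.ofFn_eq_map, List.prod_ofFn] at this
    simp only [this, mul_one, G.dual_apply hc]

/-- The elements on which each `D r i` acts as `w i` times `Z r`. -/
noncomputable def chainSubfield (c : Fin n → V) : Subfield K where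
  carrier := {y | ∀ r i, G.D r i y = G.w c i * G.Z r y}
  mul_mem' hx hy r i := by
    simp only [Derivation.leibniz, hx r i, hy r i, smul_eq_mul]
    ring
  one_mem' r i := by simp
  add_mem' hx hy r i := by
    simp only [map_add, hx r i, hy r i, mul_add]
  zero_mem' r i := by simp
  neg_mem' hx r i := by
    simp only [map_neg, hx r i, mul_neg]
  inv_mem' x hx r i := by
    simp only [Derivation.leibniz_inv, hx r i, smul_eq_mul]
    ring

variable [CharP K 2]

theorem w_mem_chainSubfield (hc : Function.Injective c) (v : V) :
    G.w c v ∈ G.chainSubfield c := fun r i => by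
  rw [G.D_w hc, G.Z_w hc]

theorem D_inv_det_mul (hc : Function.Injective c) {y : K} (hy : y ∈ G.chainSubfield c)
    (r : Fin n) (i : V) :
    G.D r i ((G.mat c).det⁻¹ * y) = G.Z r ((G.mat c).det⁻¹ * (G.w c i * y)) := by
  have h := G.det_mat_ne_zero hc
  simp only [Derivation.leibniz, Derivation.leibniz_inv, hy r i, G.D_det hc, G.Z_det, G.Z_w hc,
    smul_eq_mul, CharTwo.neg_eq]
  field_simp
  ring

theorem iterDerivation_D_inv_det_mul (hc : Function.Injective c) {y : K}
    (hy : y ∈ G.chainSubfield c) (I : Fin n → V) (l : List (Fin n)) :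
    iterDerivation (fun r => G.D r (I r)) l ((G.mat c).det⁻¹ * y) =
      iterDerivation G.Z l ((G.mat c).det⁻¹ * ((l.map fun r => G.w c (I r)).prod * y)) := by
  induction l with
  | nil => simp [iterDerivation_nil]
  | cons r l ih =>
    have hmem : (l.map fun r => G.w c (I r)).prod * y ∈ G.chainSubfield c := by
      refine mul_mem (list_prod_mem fun x hx => ?_) hy
      obtain ⟨q, _, rfl⟩ := List.mem_map.mp hx
      exact G.w_mem_chainSubfield hc _
    rw [iterDerivation_cons, iterDerivation_cons, ih,
      iterDerivation_comm _ _ _ fun q x => G.D_Z_comm _ _ q x, G.D_inv_det_mul hc hmem,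
      iterDerivation_comm _ _ _ fun q x => G.Z_comm _ q x, List.map_cons, List.prod_cons, mul_assoc]

/-- The contribution of a facet with vertices `c` to the degree of the empty monomial. -/
noncomputable def kappa (c : Fin n → V) : K := (G.mat c).det⁻¹ * (∏ s, G.w c (c s))⁻¹

theorem iterDerivation_D_kappa_mul (hc : Function.Injective c) (I : Fin n → V) {y q : K}
    (hy : y ∈ G.chainSubfield c) (h : (∏ r, G.w c (I r)) * y = q ^ 2) :
    iterDerivation (fun r => G.D r (I r)) (List.finRange n) (G.kappa c * y) =
      (G.kappa c * q) ^ 2 := by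
  have hW : ∏ s, G.w c (c s) ∈ G.chainSubfield c :=
    prod_mem fun s _ => G.w_mem_chainSubfield hc _
  have hW0 : ∏ s, G.w c (c s) ≠ 0 := Finset.prod_ne_zero_iff.mpr fun s _ => G.w_ne_zero hc s
  have h1 : (G.mat c).det⁻¹ * (((List.finRange n).map fun r => G.w c (I r)).prod *
      ((∏ s, G.w c (c s))⁻¹ * y)) =
      (q * (∏ s, G.w c (c s))⁻¹) ^ 2 * ((G.mat c).det⁻¹ * ∏ s, G.w c (c s)) := by
    rw [← List.ofFn_eq_map, List.prod_ofFn, mul_left_comm (∏ r, G.w c (I r)), h]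
    field_simp
  rw [kappa, mul_assoc, G.iterDerivation_D_inv_det_mul hc (mul_mem (inv_mem hW) hy), h1,
    iterDerivation_sq_mul, iterDerivation_mul_of_eq_zero, G.iterDerivation_Z_prod_w hc]
  · ring
  · intro r _
    rw [Derivation.leibniz_inv, G.Z_det, smul_zero]

end GenericFrame

theorem exists_perm_of_range_eq {ι X : Type*} {c c' : ι → X} (hc : Function.Injective c)
    (hc' : Function.Injective c') (h : Set.range c = Set.range c') :
    ∃ σ : Equiv.Perm ι, ∀ s, c (σ s) = c' s := by
  refine ⟨(Equiv.ofInjective c' hc').trans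
    ((Equiv.setCongr h.symm).trans (Equiv.ofInjective c hc).symm), fun s => ?_⟩
  simp [Equiv.apply_ofInjective_symm]

theorem Matrix.det_eq_of_range_eq {m R X : Type*} [Fintype m] [DecidableEq m] [CommRing R]
    [CharP R 2] (col : X → m → R) {c c' : m → X} (hc : Function.Injective c)
    (hc' : Function.Injective c') (h : Set.range c = Set.range c') :
    (Matrix.of fun r s => col (c s) r).det = (Matrix.of fun r s => col (c' s) r).det := by
  obtain ⟨σ, hσ⟩ := exists_perm_of_range_eq hc hc' h
  have h1 : (Matrix.of fun r s => col (c' s) r) =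
      (Matrix.of fun r s => col (c s) r).submatrix id σ := by
    ext r s
    simp [hσ]
  rw [h1, Matrix.det_permute']
  rcases Int.units_eq_one_or (Equiv.Perm.sign σ) with h | h <;> simp [h, CharTwo.neg_eq]

theorem Multiset.exists_map_univ_eq {V : Type*} (m : Multiset V) {n : ℕ} (h : m.card = n) :
    ∃ I : Fin n → V, Finset.univ.val.map I = m := by
  induction m using Quotient.inductionOn with
  | h l =>
    obtain rfl : l.length = n := h
    exact ⟨l.get, by simp [Fin.univ_val_map]⟩

theorem Finset.univ_map_eq_of_range_eq {V : Type*} {n : ℕ} {F : Finset V} {c : Fin n → V}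
    (hc : Function.Injective c) (hF : Set.range c = F) : Finset.univ.map ⟨c, hc⟩ = F := by
  ext v
  simp [← Finset.mem_coe, ← hF]

theorem Finset.prod_comp_of_range_eq {V : Type*} {n : ℕ} {F : Finset V} {c : Fin n → V}
    (hc : Function.Injective c) (hF : Set.range c = F) {M : Type*} [CommMonoid M] (f : V → M) :
    ∏ s, f (c s) = ∏ v ∈ F, f v := by
  rw [← Finset.univ_map_eq_of_range_eq hc hF, Finset.prod_map]
  rfl

theorem Finset.card_eq_of_range_eq {V : Type*} {n : ℕ} {F : Finset V} {c : Fin n → V}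
    (hc : Function.Injective c) (hF : Set.range c = F) : F.card = n := by
  rw [← Finset.univ_map_eq_of_range_eq hc hF]
  simp

namespace GenericFrame

variable {n : ℕ} {V K : Type*} [DecidableEq V] [Field K] (G : GenericFrame n V K)
  (𝔽 : Finset (Finset V)) (e : Finset V → Fin n → V)

/-- The degree of a monomial `m`, as a sum over the facets `𝔽`
enumerated by `e`. -/
noncomputable def deg (m : Multiset V) : K :=
  ∑ F ∈ 𝔽, G.kappa (e F) * (m.map (G.w (e F))).prod

variable {𝔽 e} (he : ∀ F ∈ 𝔽, Function.Injective (e F)) (heF : ∀ F ∈ 𝔽, Set.range (e F) = F)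

include heF in
theorem deg_eq_zero {m : Multiset V} (h : ∀ F ∈ 𝔽, ∃ v ∈ m, v ∉ F) : G.deg 𝔽 e m = 0 := by
  refine Finset.sum_eq_zero fun F hF => ?_
  obtain ⟨v, hv, hvF⟩ := h F hF
  rw [Multiset.prod_eq_zero, mul_zero]
  refine Multiset.mem_map.mpr ⟨v, hv, G.w_eq_zero ?_⟩
  rwa [heF F hF]

include he heF in
theorem deg_facet {F : Finset V} (hF : F ∈ 𝔽) : G.deg 𝔽 e F.val ≠ 0 := by
  have h1 : G.deg 𝔽 e F.val = (G.mat (e F)).det⁻¹ := by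
    rw [deg, Finset.sum_eq_single_of_mem F hF]
    · have h2 : (F.val.map (G.w (e F))).prod = ∏ s, G.w (e F) (e F s) :=
        (Finset.prod_comp_of_range_eq (he F hF) (heF F hF) _).symm
      have h3 : ∏ s, G.w (e F) (e F s) ≠ 0 :=
        Finset.prod_ne_zero_iff.mpr fun s _ => G.w_ne_zero (he F hF) s
      rw [h2, kappa, mul_assoc, inv_mul_cancel₀ h3, mul_one]
    · intro F' hF' hne
      have : ¬ F ⊆ F' := fun h => hne (Finset.eq_of_subset_of_card_le h (by
        rw [Finset.card_eq_of_range_eq (he F hF) (heF F hF),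
          Finset.card_eq_of_range_eq (he F' hF') (heF F' hF')])).symm
      obtain ⟨v, hv, hv'⟩ := Finset.not_subset.mp this
      rw [Multiset.prod_eq_zero, mul_zero]
      refine Multiset.mem_map.mpr ⟨v, hv, G.w_eq_zero ?_⟩
      rwa [heF F' hF']
  rw [h1]
  exact inv_ne_zero (G.det_mat_ne_zero (he F hF))

include he in
theorem B_deg (v : V) (m : Multiset V) : G.B v (G.deg 𝔽 e m) = 0 := by
  rw [deg, map_sum]
  refine Finset.sum_eq_zero fun F hF => ?_
  have h1 : ∀ t : Multiset V, G.B v (t.map (G.w (e F))).prod = 0 := by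
    intro t
    induction t using Multiset.induction_on with
    | empty => simp
    | cons u t ih =>
      rw [Multiset.map_cons, Multiset.prod_cons, Derivation.leibniz, ih, G.B_w (he F hF)]
      simp
  simp only [Derivation.leibniz, h1, kappa, Derivation.leibniz_inv, G.B_det,
    Derivation.map_prod_eq_zero _ _ _ fun s _ => G.B_w (he F hF) _ _]
  simp

include he in
theorem sum_mul_deg_cons [Fintype V] (m : Multiset V) (l : Fin n → K) :
    ∑ v, (∑ r, l r * G.a r v) * G.deg 𝔽 e (v ::ₘ m) = (∑ r, l r * G.z r) * G.deg 𝔽 e m := by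
  simp only [deg, Multiset.map_cons, Multiset.prod_cons, Finset.mul_sum]
  rw [Finset.sum_comm]
  refine Finset.sum_congr rfl fun F hF => ?_
  simp only [← G.sum_univ_a_mul_w (he F hF), Finset.mul_sum, Finset.sum_mul]
  rw [Finset.sum_comm]
  refine Finset.sum_congr rfl fun r _ => Finset.sum_congr rfl fun v _ => by ring

/-- The column `z` for `none` and the column `a · v` for `some v`. -/
def optionColumn (o : Option V) (r : Fin n) : K := o.elim (G.z r) (G.a r)

theorem kappa_mul_prod_of_subset [CharP K 2] {F U : Finset V} {c : Fin n → V}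
    (hc : Function.Injective c) (hF : Set.range c = F) (hUF : U ⊆ F) (hU : U.card + 1 = n) :
    ∃ t : Fin n → Option V, Function.Injective t ∧
      Set.range t = insert none (some '' (U : Set V)) ∧
      G.kappa c * (U.val.map (G.w c)).prod =
        (Matrix.of fun r s => G.optionColumn (t s) r).det⁻¹ := by
  have hcard := Finset.card_eq_of_range_eq hc hF
  obtain ⟨v, hv⟩ : ∃ v, F \ U = {v} := by
    rw [← Finset.card_eq_one, Finset.card_sdiff_of_subset hUF]
    omega
  have hvF : v ∈ F \ U := by simp [hv]
  rw [Finset.mem_sdiff] at hvF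
  have hFU : F = insert v U := by
    rw [← Finset.sdiff_union_of_subset hUF, hv]
    rfl
  obtain ⟨s₀, rfl⟩ : v ∈ Set.range c := by
    rw [hF]
    exact hvF.1
  have hmem : ∀ s, s ≠ s₀ → c s ∈ U := by
    intro s hs
    have : c s ∈ F := by
      rw [← Finset.mem_coe, ← hF]
      exact Set.mem_range_self s
    rw [hFU, Finset.mem_insert, hc.eq_iff] at this
    exact this.resolve_left hs
  refine ⟨fun s => if s = s₀ then none else some (c s), ?_, ?_, ?_⟩
  · intro s s' h
    by_cases h1 : s = s₀ <;> by_cases h2 : s' = s₀ <;> simp_all [hc.eq_iff]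
  · ext o
    constructor
    · rintro ⟨s, rfl⟩
      by_cases h1 : s = s₀
      · simp [h1]
      · simp [h1, hmem s h1]
    · rintro (rfl | ⟨u, hu, rfl⟩)
      · exact ⟨s₀, by simp⟩
      · obtain ⟨s, rfl⟩ : u ∈ Set.range c := by
          rw [hF]
          exact hUF hu
        exact ⟨s, if_neg (by rintro rfl; exact hvF.2 hu)⟩
  · have h1 : (Matrix.of fun r s => G.optionColumn (if s = s₀ then none else some (c s)) r) =
        (G.mat c).updateCol s₀ G.z := by
      ext r s
      rw [Matrix.updateCol_apply, Matrix.of_apply]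
      split_ifs <;> rfl
    have h2 : (∏ s, G.w c (c s)) = G.w c (c s₀) * (U.val.map (G.w c)).prod := by
      rw [Finset.prod_comp_of_range_eq hc hF, hFU, Finset.prod_insert hvF.2]
      rfl
    have h3 : G.w c (c s₀) = (G.mat c).det⁻¹ * ((G.mat c).updateCol s₀ G.z).det := by
      rw [G.w_apply hc, Matrix.inv_def, Matrix.smul_mulVec, Pi.smul_apply,
        ← Matrix.cramer_eq_adjugate_mulVec, Matrix.cramer_apply, smul_eq_mul,
        Ring.inverse_eq_inv']
    have h4 := G.w_ne_zero hc s₀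
    have h5 : (U.val.map (G.w c)).prod ≠ 0 := by
      intro h
      exact Finset.prod_ne_zero_iff.mpr (fun s _ => G.w_ne_zero hc s) (h2.trans (by simp [h]))
    have h6 := G.det_mat_ne_zero hc
    rw [h1, kappa, h2]
    rw [h3] at h4 ⊢
    have h7 : ((G.mat c).updateCol s₀ G.z).det ≠ 0 := right_ne_zero_of_mul h4
    field_simp

variable [CharP K 2]

include he heF in
theorem deg_eq_zero_of_nodup (heven : ∀ U : Finset V, U.card + 1 = n → Even {F ∈ 𝔽 | U ⊆ F}.card)
    {U : Finset V} (hU : U.card + 1 = n) : G.deg 𝔽 e U.val = 0 := by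
  have h1 : G.deg 𝔽 e U.val =
      ∑ F ∈ 𝔽 with U ⊆ F, G.kappa (e F) * (U.val.map (G.w (e F))).prod := by
    rw [deg, Finset.sum_filter_of_ne]
    intro F hF h
    by_contra hUF
    obtain ⟨v, hv, hv'⟩ := Finset.not_subset.mp hUF
    apply h
    rw [Multiset.prod_eq_zero, mul_zero]
    refine Multiset.mem_map.mpr ⟨v, hv, G.w_eq_zero ?_⟩
    rwa [heF F hF]
  rw [h1]
  rcases ({F ∈ 𝔽 | U ⊆ F}).eq_empty_or_nonempty with h | ⟨F₀, hF₀⟩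
  · rw [h, Finset.sum_empty]
  have hF₀' := Finset.mem_filter.mp hF₀
  obtain ⟨t₀, ht₀, hr₀, hd₀⟩ := G.kappa_mul_prod_of_subset (he F₀ hF₀'.1) (heF F₀ hF₀'.1) hF₀'.2 hU
  rw [Finset.sum_eq_card_nsmul (b := (Matrix.of fun r s => G.optionColumn (t₀ s) r).det⁻¹)]
  · obtain ⟨k, hk⟩ := heven U hU
    rw [hk, add_nsmul, CharTwo.add_self_eq_zero]
  · intro F hF
    have hF' := Finset.mem_filter.mp hF
    obtain ⟨t, ht, hr, hd⟩ := G.kappa_mul_prod_of_subset (he F hF'.1) (heF F hF'.1) hF'.2 hU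
    rw [hd, Matrix.det_eq_of_range_eq _ ht ht₀ (hr.trans hr₀.symm)]

include he heF in
theorem deg_eq_zero_of_card [Fintype V]
    (heven : ∀ U : Finset V, U.card + 1 = n → Even {F ∈ 𝔽 | U ⊆ F}.card)
    (m : Multiset V) (hm : m.card + 1 = n) : G.deg 𝔽 e m = 0 := by
  induction hk : n - m.toFinset.card using Nat.strong_induction_on generalizing m with
  | _ k ih =>
  by_cases hnd : m.Nodup
  · exact G.deg_eq_zero_of_nodup he heF heven (U := ⟨m, hnd⟩) hm
  by_cases hex : ∀ F ∈ 𝔽, ∃ v ∈ m, v ∉ F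
  · exact G.deg_eq_zero heF hex
  push Not at hex
  obtain ⟨F, hF, hmF⟩ := hex
  obtain ⟨v, hv⟩ : ∃ v, 2 ≤ m.count v := by
    by_contra! h
    exact hnd (Multiset.nodup_iff_count_le_one.mpr fun v => by have := h v; omega)
  obtain ⟨m', rfl⟩ := Multiset.exists_cons_of_mem
    (Multiset.count_pos.mp (by omega : 0 < m.count v))
  have hvm' : v ∈ m' := by
    rw [Multiset.count_cons_self] at hv
    exact Multiset.count_pos.mp (by omega)
  have hsupp : (v ::ₘ m').toFinset = m'.toFinset := by
    simp [hvm']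
  rw [hsupp] at hk
  have hle : m'.toFinset.card ≤ m'.card := Multiset.toFinset_card_le m'
  rw [Multiset.card_cons] at hm
  obtain ⟨u, huF, hu⟩ : ∃ u ∈ F, u ∉ m'.toFinset := by
    by_contra! h
    have := Finset.card_le_card (show F ⊆ m'.toFinset from h)
    rw [Finset.card_eq_of_range_eq (he F hF) (heF F hF)] at this
    omega
  have hinj := he F hF
  obtain ⟨s, rfl⟩ : u ∈ Set.range (e F) := by
    rw [heF F hF]
    exact huF
  have hwu := G.w_ne_zero hinj s
  have key := G.sum_mul_deg_cons he m' (fun r => G.dual (e F) v r +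
    G.w (e F) v / G.w (e F) (e F s) * G.dual (e F) (e F s) r)
  simp only [add_mul, Finset.sum_add_distrib, mul_assoc, ← Finset.mul_sum] at key
  rw [G.sum_dual_mul_z hinj, G.sum_dual_mul_z hinj,
    ← mul_assoc (G.w (e F) v / _) (G.w _ _), div_mul_cancel₀ _ hwu,
    CharTwo.add_self_eq_zero, Finset.mul_sum, ← Finset.sum_add_distrib,
    Finset.sum_eq_single_of_mem v (Finset.mem_univ v)] at key
  · obtain ⟨t, rfl⟩ : v ∈ Set.range (e F) := by
      rw [heF F hF]
      exact hmF v (by simp)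
    rw [G.sum_dual_mul_a hinj, G.sum_dual_mul_a hinj, if_pos rfl, if_neg] at key
    · simpa using key
    · intro h
      rw [h] at hu
      exact hu (by simpa using hvm')
  · intro x _ hxv
    by_cases hx : x ∈ m'
    · obtain ⟨t, rfl⟩ : x ∈ Set.range (e F) := by
        rw [heF F hF]
        exact hmF x (by simp [hx])
      rw [G.sum_dual_mul_a hinj, G.sum_dual_mul_a hinj, if_neg hxv.symm, if_neg]
      · simp
      · intro h
        rw [h] at hu
        exact hu (by simpa using hx)
    · rw [ih _ _ (x ::ₘ m') (by simpa using hm) rfl, mul_zero, mul_zero, mul_zero, add_zero]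
      rw [Multiset.toFinset_cons, Finset.card_insert_of_notMem (by simpa using hx)]
      omega

include he heF in
theorem sum_mul_deg_cons_eq_zero [Fintype V]
    (heven : ∀ U : Finset V, U.card + 1 = n → Even {F ∈ 𝔽 | U ⊆ F}.card)
    (m : Multiset V) (hm : m.card + 1 = n) (l : Fin n → K) :
    ∑ v, (∑ r, l r * G.a r v) * G.deg 𝔽 e (v ::ₘ m) = 0 := by
  rw [G.sum_mul_deg_cons he, G.deg_eq_zero_of_card he heF heven m hm, mul_zero]

include he in
theorem sum_mul_deg_eq_zero_of_sum_sq {J : Type*} (s : Finset J) (l : J → K)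
    (m : J → Multiset V) (i : ℕ) (L : Multiset V)
    (hL : L.card + 2 * i = n) (h : ∑ j ∈ s, l j ^ 2 * G.deg 𝔽 e (m j + m j + L) = 0)
    (t : Multiset V) (ht : t.card = i) : ∑ j ∈ s, l j * G.deg 𝔽 e (m j + L + t) = 0 := by
  obtain ⟨I, hI⟩ := (L + t + t).exists_map_univ_eq (n := n) (by simp; omega)
  have h1 : ∀ F ∈ 𝔽, ∀ j, iterDerivation (fun r => G.D r (I r)) (List.finRange n)
      (G.kappa (e F) * ((m j + m j + L).map (G.w (e F))).prod) =
      (G.kappa (e F) * ((m j + L + t).map (G.w (e F))).prod) ^ 2 := by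
    intro F hF j
    apply G.iterDerivation_D_kappa_mul (he F hF)
    · refine multiset_prod_mem _ fun x hx => ?_
      obtain ⟨v, _, rfl⟩ := Multiset.mem_map.mp hx
      exact G.w_mem_chainSubfield (he F hF) v
    · have : ∏ r, G.w (e F) (I r) = ((L + t + t).map (G.w (e F))).prod := by
        rw [← hI, Multiset.map_map]
        rfl
      rw [this]
      simp only [Multiset.map_add, Multiset.prod_add]
      ring
  have h2 := congrArg (iterDerivation (fun r => G.D r (I r)) (List.finRange n)) h
  rw [map_zero, map_sum] at h2
  simp only [iterDerivation_sq_mul] at h2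
  rw [← pow_eq_zero_iff two_ne_zero, CharTwo.sum_sq, ← h2]
  refine Finset.sum_congr rfl fun j _ => ?_
  rw [mul_pow, deg, deg, CharTwo.sum_sq, map_sum]
  congr 1
  exact Finset.sum_congr rfl fun F hF => (h1 F hF j).symm

end GenericFrame

theorem CharTwo.sum_sum_eq_sum_diag {J K : Type*} [Field K] [CharP K 2] (s : Finset J)
    (f : J → J → K) (hf : ∀ i j, f i j = f j i) :
    ∑ i ∈ s, ∑ j ∈ s, f i j = ∑ i ∈ s, f i i := by
  classical
  induction s using Finset.induction_on with
  | empty => simp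
  | insert a s ha ih =>
    simp only [Finset.sum_insert ha, Finset.sum_add_distrib, ih]
    rw [Finset.sum_congr rfl fun j _ => hf a j, add_assoc, ← add_assoc (∑ _ ∈ s, _),
      CharTwo.add_self_eq_zero, zero_add]

theorem Multiset.exists_le_card_eq {V : Type*} (m : Multiset V) {i : ℕ} (h : i ≤ m.card) :
    ∃ t ≤ m, t.card = i := by
  obtain ⟨t, ht⟩ := Multiset.card_pos_iff_exists_mem.mp
    (by rw [Multiset.card_powersetCard]; exact Nat.choose_pos h : 0 < (m.powersetCard i).card)
  exact ⟨t, Multiset.mem_powersetCard.mp ht⟩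

theorem exists_linear_relation {ι κ K : Type*} [Field K] (s : Finset ι) (t : Finset κ)
    (h : t.card < s.card) (c : ι → κ → K) :
    ∃ μ : ι → K, (∃ i ∈ s, μ i ≠ 0) ∧ ∀ j ∈ t, ∑ i ∈ s, μ i * c i j = 0 := by
  classical
  let T : (s → K) →ₗ[K] (t → K) := Matrix.mulVecLin (Matrix.of fun j i => c i j)
  have hT : LinearMap.ker T ≠ ⊥ := LinearMap.ker_ne_bot_of_finrank_lt (by simpa using h)
  obtain ⟨x, hx, hx0⟩ := Submodule.exists_mem_ne_zero_of_ne_bot hT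
  obtain ⟨i, hi⟩ := Function.ne_iff.mp hx0
  refine ⟨fun i => if hi : i ∈ s then x ⟨i, hi⟩ else 0, ⟨i, i.2, by simpa using hi⟩, ?_⟩
  intro j hj
  have := congrFun (LinearMap.mem_ker.mp hx) ⟨j, hj⟩
  rw [← Finset.sum_coe_sort]
  simpa [T, Matrix.mulVec, dotProduct, mul_comm] using this

/-- The facets of a pseudomanifold of dimension `n - 1`, with a partition of its faces into the
intervals `[R F, F]` which is compatible with the order of the facets by `η`, and such that the
intervals `[F \ R F, F]` are compatible with the reverse order. -/
structure ShelledComplex (n : ℕ) (V : Type*) [DecidableEq V] where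
  facets : Finset (Finset V)
  R : Finset V → Finset V
  η : Finset V → ℝ
  card_eq : ∀ F ∈ facets, F.card = n
  even_card : ∀ U : Finset V, U.card + 1 = n → Even {F ∈ facets | U ⊆ F}.card
  R_subset : ∀ F ∈ facets, R F ⊆ F
  lt_of_R_subset : ∀ F ∈ facets, ∀ F' ∈ facets, R F ⊆ F' → F' ≠ F → η F' < η F
  lt_of_sdiff_R_subset : ∀ F ∈ facets, ∀ F' ∈ facets, F \ R F ⊆ F' → F' ≠ F → η F < η F'

namespace ShelledComplex

variable {n : ℕ} {V : Type*} [DecidableEq V] (S : ShelledComplex n V)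

/-- The same complex with the reverse order of the facets. -/
def reverse : ShelledComplex n V where
  facets := S.facets
  R F := F \ S.R F
  η F := - S.η F
  card_eq := S.card_eq
  even_card := S.even_card
  R_subset F _ := Finset.sdiff_subset
  lt_of_R_subset F hF F' hF' h hne := neg_lt_neg (S.lt_of_sdiff_R_subset F hF F' hF' h hne)
  lt_of_sdiff_R_subset F hF F' hF' h hne := by
    rw [Finset.sdiff_sdiff_eq_self (S.R_subset F hF)] at h
    exact neg_lt_neg (S.lt_of_R_subset F hF F' hF' h hne)

theorem exists_facet_of_subset {U F₀ : Finset V} (hF₀ : F₀ ∈ S.facets) (hU : U ⊆ F₀) :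
    ∃ F ∈ S.facets, S.R F ⊆ U ∧ U ⊆ F := by
  obtain ⟨F, hF, hmax⟩ := Finset.exists_max_image {F ∈ S.facets | U ⊆ F} S.η
    ⟨F₀, Finset.mem_filter.mpr ⟨hF₀, hU⟩⟩
  rw [Finset.mem_filter] at hF
  refine ⟨F, hF.1, fun v hv => ?_, hF.2⟩
  by_contra hvU
  have hvF := S.R_subset F hF.1 hv
  have hcard : (F.erase v).card + 1 = n := by
    rw [Finset.card_erase_add_one hvF, S.card_eq F hF.1]
  have hmem : F ∈ ({F' ∈ S.facets | F.erase v ⊆ F'} : Finset _) :=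
    Finset.mem_filter.mpr ⟨hF.1, Finset.erase_subset _ _⟩
  obtain ⟨F', hF', hne⟩ : ∃ F' ∈ ({F' ∈ S.facets | F.erase v ⊆ F'} : Finset _), F' ≠ F := by
    apply Finset.exists_mem_ne
    have h1 := Finset.card_pos.mpr ⟨F, hmem⟩
    obtain ⟨k, hk⟩ := S.even_card _ hcard
    omega
  rw [Finset.mem_filter] at hF'
  have h1 : S.η F < S.η F' := by
    refine S.lt_of_sdiff_R_subset F hF.1 F' hF'.1 (fun x hx => hF'.2 ?_) hne
    rw [Finset.mem_sdiff] at hx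
    exact Finset.mem_erase.mpr ⟨fun h => hx.2 (h ▸ hv), hx.1⟩
  have h2 := hmax F' (Finset.mem_filter.mpr ⟨hF'.1, fun x hx =>
    hF'.2 (Finset.mem_erase.mpr ⟨fun h => hvU (h ▸ hx), hF.2 hx⟩)⟩)
  exact absurd h1 (not_lt.mpr h2)

theorem eq_of_R_subset {U F F' : Finset V} (hF : F ∈ S.facets) (hF' : F' ∈ S.facets)
    (h : S.R F ⊆ U) (hU : U ⊆ F) (h' : S.R F' ⊆ U) (hU' : U ⊆ F') : F = F' := by
  by_contra hne
  exact lt_asymm (S.lt_of_R_subset F hF F' hF' (h.trans hU') (Ne.symm hne))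
    (S.lt_of_R_subset F' hF' F hF (h'.trans hU) hne)

theorem exists_facet_of_subset' {U F₀ : Finset V} (hF₀ : F₀ ∈ S.facets) (hU : U ⊆ F₀) :
    ∃ F ∈ S.facets, F \ S.R F ⊆ U ∧ U ⊆ F :=
  S.reverse.exists_facet_of_subset hF₀ hU

variable {K : Type*} [Field K] (G : GenericFrame n V K) {e : Finset V → Fin n → V}
  (he : ∀ F ∈ S.facets, Function.Injective (e F)) (heF : ∀ F ∈ S.facets, Set.range (e F) = F)

include he heF in
theorem eq_zero_of_eq_zero_on_sdiff_R [Fintype V] {k : ℕ} (φ : Multiset V → K)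
    (hface : ∀ m, (∀ F ∈ S.facets, ∃ v ∈ m, v ∉ F) → φ m = 0)
    (hlin : ∀ m : Multiset V, m.card + 1 = k → ∀ l : Fin n → K,
      ∑ v, (∑ r, l r * G.a r v) * φ (v ::ₘ m) = 0)
    (hR : ∀ F ∈ S.facets, (F \ S.R F).card = k → φ (F \ S.R F).val = 0)
    (m : Multiset V) (hm : m.card = k) : φ m = 0 := by
  by_cases hex : ∀ F ∈ S.facets, ∃ v ∈ m, v ∉ F
  · exact hface m hex
  push Not at hex
  obtain ⟨F₀, hF₀, hmF₀⟩ := hex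
  obtain ⟨F, hF, hRF, hmF⟩ := S.exists_facet_of_subset' hF₀
    (U := m.toFinset) (fun v hv => hmF₀ v (by simpa using hv))
  clear hmF₀ hF₀
  induction hN : {F' ∈ S.facets | S.η F < S.η F'}.card using Nat.strong_induction_on
    generalizing m F with
  | _ N ih =>
  by_cases heq : m = (F \ S.R F).val
  · rw [heq]
    exact hR F hF (by rw [Finset.card_def, ← heq, hm])
  have hle : (F \ S.R F).val ≤ m := by
    rw [Multiset.le_iff_subset (F \ S.R F).nodup]
    exact fun v hv => by simpa using hRF hv
  obtain ⟨v, hv⟩ := Multiset.lt_iff_cons_le.mp (lt_of_le_of_ne hle (Ne.symm heq))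
  obtain ⟨m', rfl⟩ := Multiset.exists_cons_of_mem
    (Multiset.mem_of_le hv (Multiset.mem_cons_self v _))
  have hle' : (F \ S.R F).val ≤ m' := (Multiset.cons_le_cons_iff v).mp hv
  have hlin' := hlin m' (by simpa using hm) (G.dual (e F) v)
  rw [Finset.sum_eq_single_of_mem v (Finset.mem_univ v)] at hlin'
  · obtain ⟨s, rfl⟩ : v ∈ Set.range (e F) := by
      rw [heF F hF]
      exact hmF (by simp)
    rwa [G.sum_dual_mul_a (he F hF), if_pos rfl, one_mul] at hlin'
  · intro x _ hxv
    by_cases hx : x ∈ Set.range (e F)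
    · obtain ⟨s, rfl⟩ := hx
      rw [G.sum_dual_mul_a (he F hF), if_neg hxv.symm, zero_mul]
    · rw [heF F hF, Finset.mem_coe] at hx
      suffices h : φ (x ::ₘ m') = 0 by rw [h, mul_zero]
      by_cases hex : ∀ F ∈ S.facets, ∃ v ∈ x ::ₘ m', v ∉ F
      · exact hface _ hex
      push Not at hex
      obtain ⟨F₁, hF₁, hmF₁⟩ := hex
      obtain ⟨F', hF', hRF', hmF'⟩ := S.exists_facet_of_subset' hF₁
        (U := (x ::ₘ m').toFinset) (fun v hv => hmF₁ v (by simpa using hv))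
      have hlt : S.η F < S.η F' := by
        refine S.lt_of_sdiff_R_subset F hF F' hF' (fun u hu => hmF' ?_) ?_
        · simp [Multiset.mem_of_le hle' hu]
        · rintro rfl
          exact hx (hmF' (by simp))
      refine ih _ ?_ _ (by simpa using hm) F' hF' hRF' hmF' rfl
      rw [← hN]
      refine Finset.card_lt_card (Finset.ssubset_iff_of_subset ?_ |>.mpr ⟨F', ?_, ?_⟩)
      · intro F₂ h
        rw [Finset.mem_filter] at h ⊢
        exact ⟨h.1, hlt.trans h.2⟩
      · exact Finset.mem_filter.mpr ⟨hF', hlt⟩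
      · simp

include he heF in
theorem sum_sq_mul_deg_eq_zero [CharP K 2] [Fintype V] {i : ℕ} (hi : 2 * i + 1 ≤ n)
    {μ : Finset V → K} (hμ : ∀ F' ∈ S.facets, (S.R F').card = i + 1 →
      ∑ F ∈ S.facets with (S.R F).card = i,
      μ F * ∑ v, G.b v * G.deg S.facets e (v ::ₘ (S.R F).val + (F' \ S.R F').val) = 0)
    (L : Multiset V) (hL : L.card + 2 * i = n) :
    ∑ F ∈ S.facets with (S.R F).card = i,
      μ F ^ 2 * G.deg S.facets e ((S.R F).val + (S.R F).val + L) = 0 := by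
  set s := {F ∈ S.facets | (S.R F).card = i} with hs
  have hcard : ∀ F ∈ s, (S.R F).val.card = i := fun F hF => (Finset.mem_filter.mp hF).2
  have hφ : ∀ g : Multiset V, g.card + i + 1 = n →
      ∑ F ∈ s, μ F * ∑ v, G.b v * G.deg S.facets e (v ::ₘ (S.R F).val + g) = 0 := by
    intro g hg
    refine S.eq_zero_of_eq_zero_on_sdiff_R G he heF (k := n - i - 1)
      (fun g => ∑ F ∈ s, μ F * ∑ v, G.b v * G.deg S.facets e (v ::ₘ (S.R F).val + g))
      ?_ ?_ ?_ g (by omega)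
    · intro m hm
      refine Finset.sum_eq_zero fun F _ => ?_
      rw [Finset.sum_eq_zero, mul_zero]
      intro v _
      rw [G.deg_eq_zero heF, mul_zero]
      intro F' hF'
      obtain ⟨u, hu, hu'⟩ := hm F' hF'
      exact ⟨u, Multiset.mem_add.mpr (Or.inr hu), hu'⟩
    · intro m hm l
      simp only [Finset.mul_sum]
      rw [Finset.sum_comm]
      refine Finset.sum_eq_zero fun F hF => ?_
      rw [Finset.sum_comm]
      refine Finset.sum_eq_zero fun v _ => ?_
      have := G.sum_mul_deg_cons_eq_zero he heF S.even_card (v ::ₘ (S.R F).val + m)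
        (by simp only [Multiset.card_add, Multiset.card_cons, hcard F hF]; omega) l
      calc _ = μ F * G.b v * ∑ x, (∑ r, l r * G.a r x) *
            G.deg S.facets e (x ::ₘ (v ::ₘ (S.R F).val + m)) := by
            rw [Finset.mul_sum]
            refine Finset.sum_congr rfl fun x _ => ?_
            rw [Multiset.add_cons]
            simp only [Finset.sum_mul, Finset.mul_sum]
            refine Finset.sum_congr rfl fun r _ => by ring
        _ = 0 := by rw [this, mul_zero]
    · intro F' hF' hk
      rw [Finset.card_sdiff_of_subset (S.R_subset F' hF'), S.card_eq F' hF'] at hk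
      have := Finset.card_le_card (S.R_subset F' hF')
      rw [S.card_eq F' hF'] at this
      exact hμ F' hF' (by omega)
  obtain ⟨u, hu⟩ := Multiset.card_pos_iff_exists_mem.mp (by omega : 0 < L.card)
  obtain ⟨g, rfl⟩ := Multiset.exists_cons_of_mem hu
  rw [Multiset.card_cons] at hL
  have hdiag : ∑ F ∈ s, μ F ^ 2 * ∑ v, G.b v *
      G.deg S.facets e (v ::ₘ ((S.R F).val + (S.R F).val + g)) = 0 := by
    have h1 := CharTwo.sum_sum_eq_sum_diag s (fun F F' => μ F * μ F' * ∑ v, G.b v *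
      G.deg S.facets e (v ::ₘ ((S.R F).val + (S.R F').val + g))) fun F F' => by
        rw [mul_comm (μ F), add_comm (S.R F).val]
    simp only [← sq] at h1
    rw [← h1]
    rw [Finset.sum_comm]
    refine Finset.sum_eq_zero fun F' hF' => ?_
    have h2 := hφ ((S.R F').val + g) (by rw [Multiset.card_add, hcard F' hF']; omega)
    calc _ = μ F' * ∑ F ∈ s, μ F * ∑ v, G.b v *
          G.deg S.facets e (v ::ₘ (S.R F).val + ((S.R F').val + g)) := by
          rw [Finset.mul_sum]
          refine Finset.sum_congr rfl fun F _ => ?_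
          simp only [Multiset.cons_add, add_assoc]
          ring
      _ = 0 := by rw [h2, mul_zero]
  have h3 := congrArg (G.B u) hdiag
  simp only [map_sum, Derivation.map_sq_mul, map_zero] at h3
  simp only [Derivation.leibniz, G.B_deg he, G.B_b, zero_add, smul_eq_mul, mul_ite, mul_one,
    mul_zero, Finset.sum_ite_eq, Finset.mem_univ, if_true] at h3
  simpa only [Multiset.add_cons] using h3

include he heF in
theorem eq_zero_of_sum_mul_deg_eq_zero {i : ℕ} {μ : Finset V → K}
    (hμ : ∀ F' ∈ S.facets, (S.R F').card = i → ∑ F ∈ S.facets with (S.R F).card = i,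
      μ F * G.deg S.facets e ((S.R F).val + (F' \ S.R F').val) = 0) :
    ∀ F ∈ S.facets, (S.R F).card = i → μ F = 0 := by
  classical
  by_contra! hex
  obtain ⟨F₀, hF₀, hi₀, hμ₀⟩ := hex
  obtain ⟨F', hF', hmax⟩ := Finset.exists_max_image
    {F ∈ S.facets | (S.R F).card = i ∧ μ F ≠ 0} S.η
    ⟨F₀, Finset.mem_filter.mpr ⟨hF₀, hi₀, hμ₀⟩⟩
  obtain ⟨hF', hi', hμ'⟩ := Finset.mem_filter.mp hF'
  have h := hμ F' hF' hi'
  rw [Finset.sum_eq_single_of_mem F' (Finset.mem_filter.mpr ⟨hF', hi'⟩)] at h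
  · refine mul_ne_zero hμ' ?_ h
    have : (S.R F').val + (F' \ S.R F').val = F'.val := by
      rw [Finset.sdiff_val, add_tsub_cancel_of_le]
      exact Finset.val_le_iff.mpr (S.R_subset F' hF')
    rw [this]
    exact G.deg_facet he heF hF'
  · intro F hF hne
    obtain ⟨hF, hiF⟩ := Finset.mem_filter.mp hF
    by_cases hμF : μ F = 0
    · rw [hμF, zero_mul]
    rw [G.deg_eq_zero heF, mul_zero]
    by_contra! hex
    obtain ⟨F₁, hF₁, hsub⟩ := hex
    have h1 : S.η F₁ ≤ S.η F := by
      by_cases h : F₁ = F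
      · rw [h]
      · exact (S.lt_of_R_subset F hF F₁ hF₁
          (fun v hv => hsub v (Multiset.mem_add.mpr (Or.inl hv))) h).le
    have h2 : F₁ ≠ F' → S.η F' < S.η F₁ := fun h =>
      S.lt_of_sdiff_R_subset F' hF' F₁ hF₁
        (fun v hv => hsub v (Multiset.mem_add.mpr (Or.inr hv))) h
    have h3 := hmax F (Finset.mem_filter.mpr ⟨hF, hiF, hμF⟩)
    by_cases h4 : F₁ = F'
    · subst h4
      exact absurd (S.lt_of_R_subset F hF F₁ hF'
        (fun v hv => hsub v (Multiset.mem_add.mpr (Or.inl hv))) hne.symm) (not_lt.mpr h3)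
    · linarith [h2 h4]

theorem card_le_card_succ [Fintype V] {i : ℕ} (hi : 2 * i + 1 ≤ n) :
    {F ∈ S.facets | (S.R F).card = i}.card ≤ {F ∈ S.facets | (S.R F).card = i + 1}.card := by
  by_contra! hlt
  obtain ⟨F₀, hF₀⟩ := Finset.card_pos.mp (Nat.zero_lt_of_lt hlt)
  have hF₀c := S.card_eq F₀ (Finset.mem_filter.mp hF₀).1
  obtain ⟨v₀, _⟩ := Finset.card_pos.mp (by omega : 0 < F₀.card)
  have : Nonempty V := ⟨v₀⟩
  obtain ⟨e, he⟩ : ∃ e : Finset V → Fin n → V, ∀ F ∈ S.facets,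
      Function.Injective (e F) ∧ Set.range (e F) = F := by
    have : ∀ F ∈ S.facets, ∃ c : Fin n → V, Function.Injective c ∧ Set.range c = F :=
      fun F hF => ⟨fun s => (F.equivFinOfCardEq (S.card_eq F hF)).symm s,
        Subtype.val_injective.comp (Equiv.injective _), by
          rw [← Function.comp_def, EquivLike.range_comp, Subtype.range_coe]⟩
    choose! e he using this
    exact ⟨e, he⟩
  obtain ⟨K, _, _, ⟨G⟩⟩ := exists_genericFrame n V
  have he1 := fun F hF => (he F hF).1
  have he2 := fun F hF => (he F hF).2
  obtain ⟨μ, ⟨F, hF, hμF⟩, hμ⟩ := exists_linear_relation _ _ hlt fun F F' =>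
    ∑ v, G.b v * G.deg S.facets e (v ::ₘ (S.R F).val + (F' \ S.R F').val)
  refine hμF (S.eq_zero_of_sum_mul_deg_eq_zero G he1 he2 (i := i) ?_ F
    (Finset.mem_filter.mp hF).1 (Finset.mem_filter.mp hF).2)
  intro F' hF' hi'
  have hcard : (F' \ S.R F').val.card = n - i := by
    rw [Finset.card_val, Finset.card_sdiff_of_subset (S.R_subset F' hF'), S.card_eq F' hF', hi']
  obtain ⟨t, ht, htc⟩ := (F' \ S.R F').val.exists_le_card_eq (i := i) (by omega)
  obtain ⟨L, hL⟩ := Multiset.le_iff_exists_add.mp ht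
  have hLc : L.card + 2 * i = n := by
    rw [hL, Multiset.card_add] at hcard
    omega
  have := G.sum_mul_deg_eq_zero_of_sum_sq he1 _ μ (fun F => (S.R F).val) i L hLc
    (S.sum_sq_mul_deg_eq_zero G he1 he2 hi (fun F' hF' h =>
      hμ F' (Finset.mem_filter.mpr ⟨hF', h⟩)) L hLc) t htc
  rw [hL]
  simpa only [add_assoc, add_comm t] using this

end ShelledComplex

theorem sum_neg_one_pow_mul_choose_mul_choose {n i : ℕ} (hi : i ≤ n) (r : ℕ) :
    ∑ j ∈ Finset.range (i + 1), (-1 : ℤ) ^ (i - j) * ((n - j).choose (i - j)) *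
      (if r ≤ j then ((n - r).choose (j - r) : ℤ) else 0) = if r = i then 1 else 0 := by
  by_cases hri : r ≤ i
  · obtain ⟨k, rfl⟩ := Nat.exists_eq_add_of_le hri
    have h1 : ∀ s ∈ Finset.range (k + 1),
        (-1 : ℤ) ^ (r + k - (r + s)) * ((n - (r + s)).choose (r + k - (r + s))) *
        (if r ≤ r + s then ((n - r).choose (r + s - r) : ℤ) else 0) =
        (-1) ^ k * (n - r).choose k * ((-1) ^ s * k.choose s) := by
      intro s hs
      have hsk : s ≤ k := Nat.lt_succ_iff.mp (Finset.mem_range.mp hs)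
      obtain ⟨t, rfl⟩ := Nat.exists_eq_add_of_le hsk
      have h2 := Nat.choose_mul (n := n - r) (k := s + t) (s := s) (by omega)
      rw [if_pos (Nat.le_add_right r s), Nat.add_sub_cancel_left, Nat.add_sub_add_left,
        Nat.add_sub_cancel_left, Nat.sub_add_eq]
      rw [Nat.add_sub_cancel_left] at h2
      have h3 : (((n - r).choose (s + t) : ℤ) * ((s + t).choose s)) =
        ((n - r).choose s) * ((n - r - s).choose t) := by exact_mod_cast h2
      have h4 : ((-1 : ℤ) ^ s) * (-1) ^ s = 1 := by
        rw [← mul_pow]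
        simp
      calc _ = (-1) ^ t * (((n - r).choose s : ℤ) * ((n - r - s).choose t)) := by ring
        _ = ((-1) ^ s * (-1) ^ s) * (-1) ^ t * (((n - r).choose s : ℤ) *
            ((n - r - s).choose t)) := by rw [h4, one_mul]
        _ = _ := by
          rw [← h3, pow_add]
          ring
    rw [Finset.range_eq_Ico, ← Finset.sum_Ico_consecutive _ (Nat.zero_le r) (by omega),
      Finset.sum_eq_zero, zero_add, Finset.sum_Ico_eq_sum_range,
      show r + k + 1 - r = k + 1 by omega, Finset.sum_congr rfl h1, ← Finset.mul_sum,
      Int.alternating_sum_range_choose]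
    · by_cases hk : k = 0 <;> simp [hk]
    · intro j hj
      rw [Finset.mem_Ico] at hj
      rw [if_neg (by omega), mul_zero]
  · rw [if_neg (by omega)]
    refine Finset.sum_eq_zero fun j hj => ?_
    rw [Finset.mem_range] at hj
    rw [if_neg (by omega), mul_zero]

namespace ShelledComplex

variable {n : ℕ} {V : Type*} [DecidableEq V] (S : ShelledComplex n V)

/-- The faces with `k` vertices. -/
def faces (k : ℕ) : Finset (Finset V) := S.facets.biUnion fun F => F.powersetCard k

theorem card_faces (k : ℕ) : (S.faces k).card = ∑ F ∈ S.facets,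
    if (S.R F).card ≤ k then (n - (S.R F).card).choose (k - (S.R F).card) else 0 := by
  have h1 : S.faces k =
      S.facets.biUnion fun F => {U ∈ F.powersetCard k | S.R F ⊆ U} := by
    ext U
    simp only [faces, Finset.mem_biUnion, Finset.mem_filter, Finset.mem_powersetCard]
    constructor
    · rintro ⟨F₀, hF₀, hU, hk⟩
      obtain ⟨F, hF, hRF, hUF⟩ := S.exists_facet_of_subset hF₀ hU
      exact ⟨F, hF, ⟨hUF, hk⟩, hRF⟩
    · rintro ⟨F, hF, h, _⟩
      exact ⟨F, hF, h⟩
  rw [h1, Finset.card_biUnion]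
  · refine Finset.sum_congr rfl fun F hF => ?_
    have hsub := S.R_subset F hF
    split_ifs with hk
    · have hn : n - (S.R F).card = (F \ S.R F).card := by
        rw [Finset.card_sdiff_of_subset hsub, S.card_eq F hF]
      rw [hn, ← Finset.card_powersetCard]
      refine Finset.card_bij' (fun U _ => U \ S.R F) (fun W _ => W ∪ S.R F) ?_ ?_ ?_ ?_
      · intro U hU
        obtain ⟨⟨hUF, hUk⟩, hRU⟩ := by
          simpa only [Finset.mem_filter, Finset.mem_powersetCard] using hU
        rw [Finset.mem_powersetCard, Finset.card_sdiff_of_subset hRU, hUk]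
        exact ⟨Finset.sdiff_subset_sdiff hUF subset_rfl, rfl⟩
      · intro W hW
        rw [Finset.mem_powersetCard, Finset.subset_sdiff] at hW
        rw [Finset.mem_filter, Finset.mem_powersetCard,
          Finset.card_union_of_disjoint hW.1.2, hW.2]
        exact ⟨⟨Finset.union_subset hW.1.1 hsub, by omega⟩, Finset.subset_union_right⟩
      · intro U hU
        exact Finset.sdiff_union_of_subset (Finset.mem_filter.mp hU).2
      · intro W hW
        rw [Finset.mem_powersetCard, Finset.subset_sdiff] at hW
        exact Finset.union_sdiff_cancel_right hW.1.2
    · rw [Finset.card_eq_zero, Finset.filter_eq_empty_iff]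
      intro U hU h
      have := Finset.card_le_card h
      rw [(Finset.mem_powersetCard.mp hU).2] at this
      exact hk this
  · intro F hF F' hF' hne
    rw [Function.onFun, Finset.disjoint_left]
    intro U hU hU'
    rw [Finset.mem_filter, Finset.mem_powersetCard] at hU hU'
    exact hne (S.eq_of_R_subset hF hF' hU.2 hU.1.1 hU'.2 hU'.1.1)

theorem sum_neg_one_pow_mul_card_faces {i : ℕ} (hi : i ≤ n) :
    ∑ j ∈ Finset.range (i + 1), (-1 : ℤ) ^ (i - j) * ((n - j).choose (i - j)) *
      ((S.faces j).card : ℤ) = {F ∈ S.facets | (S.R F).card = i}.card := by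
  simp only [S.card_faces, Nat.cast_sum, Nat.cast_ite, Nat.cast_zero, Finset.mul_sum]
  rw [Finset.sum_comm, Finset.card_filter, Nat.cast_sum]
  refine Finset.sum_congr rfl fun F _ => ?_
  rw [sum_neg_one_pow_mul_choose_mul_choose hi]
  simp

end ShelledComplex

open Module in
theorem LinearIndepOn.exists_dual_forall_eq {V E : Type*} [AddCommGroup E] [Module ℝ E]
    {p : V → E} {s : Set V} (h : LinearIndepOn ℝ p s) (f : V → ℝ) :
    ∃ q : Dual ℝ E, ∀ v ∈ s, q (p v) = f v := by
  have h' : LinearIndependent ℝ fun x : s => p x := h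
  obtain ⟨q, hq⟩ := LinearMap.exists_extend ((Basis.span h').constr ℝ fun v : s => f v)
  refine ⟨q, fun v hv => ?_⟩
  have h1 := (Basis.span h').constr_basis ℝ (fun v : s => f v) ⟨v, hv⟩
  rw [← hq, LinearMap.comp_apply, Submodule.subtype_apply, Basis.span_apply] at h1
  exact h1

open Module in
theorem exists_dual_ne_zero_of_card_lt_finrank {V E : Type*} [AddCommGroup E] [Module ℝ E]
    [FiniteDimensional ℝ E] (p : V → E) (U : Finset V) (h : U.card < finrank ℝ E) :
    ∃ q : Dual ℝ E, q ≠ 0 ∧ ∀ v ∈ U, q (p v) = 0 := by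
  classical
  have h1 : Submodule.span ℝ (U.image p : Set E) < ⊤ := by
    refine lt_of_le_of_ne le_top fun htop => ?_
    have h2 := finrank_span_finset_le_card (R := ℝ) (U.image p)
    rw [Set.finrank, htop, finrank_top] at h2
    exact absurd (h2.trans Finset.card_image_le) (not_le.mpr h)
  obtain ⟨q, hq, hle⟩ := Submodule.exists_le_ker_of_lt_top _ h1
  exact ⟨q, hq, fun v hv => hle (Submodule.subset_span (by simpa using ⟨v, hv, rfl⟩))⟩

section

open Module

variable {V E : Type*} [Fintype V] [AddCommGroup E] [Module ℝ E]

/-- The points `v` at which the functional `y` attains the value `1`. -/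
noncomputable def tightSet (p : V → E) (y : Dual ℝ E) : Finset V := {v | y (p v) = 1}

theorem mem_tightSet {p : V → E} {y : Dual ℝ E} {v : V} : v ∈ tightSet p y ↔ y (p v) = 1 := by
  simp [tightSet]

/-- The vertices of a simplicial polytope with `0` in its interior. A functional which is at most
`1` on the vertices defines the face whose vertices are its tight set. -/
structure IsSimplicialConfiguration (p : V → E) : Prop where
  exists_pos : ∀ q : Dual ℝ E, q ≠ 0 → ∃ v, 0 < q (p v)
  linearIndepOn : ∀ y : Dual ℝ E, (∀ v, y (p v) ≤ 1) → LinearIndepOn ℝ p (tightSet p y)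

namespace IsSimplicialConfiguration

variable {p : V → E} (hp : IsSimplicialConfiguration p)

include hp in
theorem exists_tightSet_eq_of_subset {y : Dual ℝ E} (hy : ∀ v, y (p v) ≤ 1) {U : Finset V}
    (hU : U ⊆ tightSet p y) : ∃ y' : Dual ℝ E, (∀ v, y' (p v) ≤ 1) ∧ tightSet p y' = U := by
  classical
  obtain ⟨q, hq⟩ := (hp.linearIndepOn y hy).exists_dual_forall_eq
    fun v => if v ∈ U then 0 else -1
  have hev : ∀ v, ∀ᶠ ε : ℝ in nhdsWithin 0 (Set.Ioi 0),
      v ∉ tightSet p y → y (p v) + ε * q (p v) < 1 := by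
    intro v
    by_cases hv : v ∈ tightSet p y
    · exact Filter.Eventually.of_forall fun _ h => absurd hv h
    · have hlt : y (p v) < 1 := lt_of_le_of_ne (hy v) fun h => hv (mem_tightSet.mpr h)
      have hc : ContinuousAt (fun ε : ℝ => y (p v) + ε * q (p v)) 0 := by fun_prop
      have := hc.eventually_lt (continuousAt_const (y := (1 : ℝ))) (by simpa using hlt)
      exact Filter.Eventually.mono (this.filter_mono nhdsWithin_le_nhds) fun ε h _ => h
  obtain ⟨ε, hε, hε0⟩ :=
    ((Filter.eventually_all.mpr hev).and self_mem_nhdsWithin).exists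
  have hval : ∀ v, v ∈ tightSet p y → (y + ε • q) (p v) = if v ∈ U then 1 else 1 - ε := by
    intro v hv
    rw [LinearMap.add_apply, LinearMap.smul_apply, mem_tightSet.mp hv, hq v hv]
    split_ifs <;> simp [sub_eq_add_neg]
  refine ⟨y + ε • q, fun v => ?_, ?_⟩
  · by_cases hv : v ∈ tightSet p y
    · rw [hval v hv]
      split_ifs <;> linarith
    · simpa using (hε v hv).le
  · ext v
    rw [mem_tightSet]
    by_cases hv : v ∈ tightSet p y
    · rw [hval v hv]
      split_ifs with h
      · simp [h]
      · simp [h, hε0.ne']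
    · have h1 : (y + ε • q) (p v) ≠ 1 := by simpa using (hε v hv).ne
      exact ⟨fun h => absurd h h1, fun h => absurd (hU h) hv⟩

include hp in
theorem exists_maximal_step {y : Dual ℝ E} (hy : ∀ v, y (p v) ≤ 1) {q : Dual ℝ E} (hq : q ≠ 0)
    (hqy : ∀ v ∈ tightSet p y, q (p v) ≤ 0) :
    ∃ t : ℝ, 0 < t ∧ (∀ v, (y + t • q) (p v) ≤ 1) ∧
      ∃ v, 0 < q (p v) ∧ v ∈ tightSet p (y + t • q) := by
  obtain ⟨v₀, hv₀⟩ := hp.exists_pos q hq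
  obtain ⟨v, hv, hmin⟩ := Finset.exists_min_image {v : V | 0 < q (p v)}
    (fun v => (1 - y (p v)) / q (p v)) ⟨v₀, by simpa using hv₀⟩
  simp only [Finset.mem_filter, Finset.mem_univ, true_and] at hv hmin
  have hlt : y (p v) < 1 := lt_of_le_of_ne (hy v) fun h =>
    absurd (hqy v (mem_tightSet.mpr h)) (not_le.mpr hv)
  have ht : 0 < (1 - y (p v)) / q (p v) := div_pos (by linarith) hv
  refine ⟨_, ht, fun u => ?_, v, hv, ?_⟩
  · rw [LinearMap.add_apply, LinearMap.smul_apply, smul_eq_mul]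
    by_cases hu : 0 < q (p u)
    · have := hmin u hu
      rw [le_div_iff₀ hu] at this
      linarith
    · have := hy u
      nlinarith
  · rw [mem_tightSet, LinearMap.add_apply, LinearMap.smul_apply, smul_eq_mul,
      div_mul_cancel₀ _ hv.ne']
    ring

variable [FiniteDimensional ℝ E]

include hp in
theorem card_tightSet_le {y : Dual ℝ E} (hy : ∀ v, y (p v) ≤ 1) :
    (tightSet p y).card ≤ finrank ℝ E := by
  simpa using (hp.linearIndepOn y hy).linearIndependent.fintype_card_le_finrank

include hp in
theorem eq_of_eq_on_tightSet {y : Dual ℝ E} (hy : ∀ v, y (p v) ≤ 1)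
    (hcard : (tightSet p y).card = finrank ℝ E) {q q' : Dual ℝ E}
    (h : ∀ v ∈ tightSet p y, q (p v) = q' (p v)) : q = q' := by
  have hspan := LinearIndependent.span_eq_top_of_card_eq_finrank'
    (hp.linearIndepOn y hy).linearIndependent (by simpa using hcard)
  refine LinearMap.ext_on hspan ?_
  rintro _ ⟨v, rfl⟩
  exact h v v.2

include hp in
theorem exists_tightSet_ssubset {y : Dual ℝ E} (hy : ∀ v, y (p v) ≤ 1)
    (h : (tightSet p y).card < finrank ℝ E) :
    ∃ y' : Dual ℝ E, (∀ v, y' (p v) ≤ 1) ∧ tightSet p y ⊂ tightSet p y' := by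
  obtain ⟨q, hq, hqU⟩ := exists_dual_ne_zero_of_card_lt_finrank p _ h
  obtain ⟨t, _, hfeas, v, hv, hvt⟩ := hp.exists_maximal_step hy hq fun v hv => (hqU v hv).le
  refine ⟨y + t • q, hfeas, Finset.ssubset_iff_of_subset ?_ |>.mpr ⟨v, hvt, ?_⟩⟩
  · intro u hu
    rw [mem_tightSet, LinearMap.add_apply, LinearMap.smul_apply, hqU u hu, mem_tightSet.mp hu]
    simp
  · exact fun hvy => hv.ne' (hqU v hvy)

include hp in
theorem exists_facet {y : Dual ℝ E} (hy : ∀ v, y (p v) ≤ 1) :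
    ∃ y' : Dual ℝ E, (∀ v, y' (p v) ≤ 1) ∧ tightSet p y ⊆ tightSet p y' ∧
      (tightSet p y').card = finrank ℝ E := by
  induction hk : finrank ℝ E - (tightSet p y).card using Nat.strong_induction_on
    generalizing y with
  | _ k ih =>
  rcases (hp.card_tightSet_le hy).eq_or_lt with h | h
  · exact ⟨y, hy, subset_rfl, h⟩
  · obtain ⟨y₁, hy₁, hss⟩ := hp.exists_tightSet_ssubset hy h
    have hlt := Finset.card_lt_card hss
    obtain ⟨y', hy', hsub, hc⟩ := ih _ (by omega) hy₁ rfl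
    exact ⟨y', hy', hss.subset.trans hsub, hc⟩

open Classical in
/-- The tight sets of maximal size. -/
noncomputable def facets (p : V → E) : Finset (Finset V) :=
  {F | ∃ y : Dual ℝ E, (∀ v, y (p v) ≤ 1) ∧ tightSet p y = F ∧ F.card = finrank ℝ E}

omit [FiniteDimensional ℝ E] in
theorem mem_facets {F : Finset V} : F ∈ facets p ↔
    ∃ y : Dual ℝ E, (∀ v, y (p v) ≤ 1) ∧ tightSet p y = F ∧ F.card = finrank ℝ E := by
  simp [facets]

include hp in
theorem exists_mem_facets_iff {U : Finset V} : (∃ F ∈ facets p, U ⊆ F) ↔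
    ∃ y : Dual ℝ E, (∀ v, y (p v) ≤ 1) ∧ tightSet p y = U := by
  constructor
  · rintro ⟨F, hF, hUF⟩
    obtain ⟨y, hy, rfl, _⟩ := mem_facets.mp hF
    exact hp.exists_tightSet_eq_of_subset hy hUF
  · rintro ⟨y, hy, rfl⟩
    obtain ⟨y', hy', hsub, hc⟩ := hp.exists_facet hy
    exact ⟨_, mem_facets.mpr ⟨y', hy', rfl, hc⟩, hsub⟩

variable [DecidableEq V]

include hp in
theorem even_card_facets (U : Finset V) (hU : U.card + 1 = finrank ℝ E) :
    Even {F ∈ facets p | U ⊆ F}.card := by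
  rcases ({F ∈ facets p | U ⊆ F}).eq_empty_or_nonempty with h | ⟨F, hF⟩
  · simp [h]
  rw [Finset.mem_filter, mem_facets] at hF
  obtain ⟨⟨y, hy, rfl, hc⟩, hUF⟩ := hF
  obtain ⟨v, hvU, hins⟩ : ∃ v, v ∉ U ∧ insert v U = tightSet p y := by
    have h1 : (tightSet p y \ U).card = 1 := by
      rw [Finset.card_sdiff_of_subset hUF]
      omega
    obtain ⟨v, hv⟩ := Finset.card_eq_one.mp h1
    refine ⟨v, (Finset.mem_sdiff.mp (hv ▸ Finset.mem_singleton_self v)).2, ?_⟩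
    rw [← Finset.sdiff_union_of_subset hUF, hv]
    rfl
  have hvT : v ∈ tightSet p y := hins ▸ Finset.mem_insert_self v U
  obtain ⟨q, hq⟩ := (hp.linearIndepOn y hy).exists_dual_forall_eq
    fun u => if u = v then -1 else 0
  have hqv : q (p v) = -1 := by simpa using hq v hvT
  have hqU : ∀ u ∈ U, q (p u) = 0 := fun u hu => by
    rw [hq u (hUF hu), if_neg]
    rintro rfl
    exact hvU hu
  have hq0 : q ≠ 0 := by
    rintro rfl
    simp at hqv
  obtain ⟨t, ht, hfeas, x, hx, hxt⟩ := hp.exists_maximal_step hy hq0 fun u hu => by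
    rw [hq u hu]
    split_ifs <;> norm_num
  have hxU : x ∉ U := fun h => hx.ne' (hqU x h)
  have hsub : insert x U ⊆ tightSet p (y + t • q) := by
    refine Finset.insert_subset hxt fun u hu => ?_
    rw [mem_tightSet, LinearMap.add_apply, LinearMap.smul_apply, hqU u hu,
      mem_tightSet.mp (hUF hu)]
    simp
  have hc' : (tightSet p (y + t • q)).card = finrank ℝ E := by
    refine le_antisymm (hp.card_tightSet_le hfeas) ?_
    rw [← hU, ← Finset.card_insert_of_notMem hxU]
    exact Finset.card_le_card hsub
  have hset : {F ∈ facets p | U ⊆ F} = {tightSet p y, tightSet p (y + t • q)} := by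
    ext F
    rw [Finset.mem_filter, mem_facets, Finset.mem_insert, Finset.mem_singleton]
    constructor
    · rintro ⟨⟨y', hy', rfl, hcF⟩, hUF'⟩
      have hy'eq : y' = y + (1 - y' (p v)) • q := by
        refine hp.eq_of_eq_on_tightSet hy hc fun u hu => ?_
        rw [LinearMap.add_apply, LinearMap.smul_apply, mem_tightSet.mp hu]
        rw [← hins, Finset.mem_insert] at hu
        rcases hu with rfl | hu
        · rw [hqv, smul_eq_mul]
          ring
        · rw [hqU u hu, mem_tightSet.mp (hUF' hu), smul_zero, add_zero]
      have ht' : 0 ≤ 1 - y' (p v) := sub_nonneg.mpr (hy' v)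
      generalize 1 - y' (p v) = t' at hy'eq ht'
      subst hy'eq
      rcases ht'.eq_or_lt with rfl | ht'
      · left
        simp
      right
      obtain ⟨w, hw, hwU⟩ : ∃ w ∈ tightSet p (y + t' • q), w ∉ U := by
        apply Finset.exists_mem_notMem_of_card_lt_card
        omega
      have hw1 := mem_tightSet.mp hw
      have hx1 := mem_tightSet.mp hxt
      have hw2 := hfeas w
      have hx2 := hy' x
      simp only [LinearMap.add_apply, LinearMap.smul_apply, smul_eq_mul] at hw1 hx1 hw2 hx2
      have hqw : 0 < q (p w) := by
        by_contra! hneg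
        have h1 : y (p w) = 1 := le_antisymm (hy w) (by nlinarith)
        have h2 := mem_tightSet.mpr h1
        rw [← hins, Finset.mem_insert] at h2
        rcases h2 with rfl | h2
        · rw [hqv] at hw1
          linarith
        · exact hwU h2
      have h1 : t' ≤ t := le_of_mul_le_mul_right (by linarith) hx
      have h2 : t ≤ t' := le_of_mul_le_mul_right (by linarith) hqw
      rw [le_antisymm h1 h2]
    · rintro (rfl | rfl)
      · exact ⟨⟨y, hy, rfl, hc⟩, hUF⟩
      · exact ⟨⟨_, hfeas, rfl, hc'⟩, (Finset.subset_insert _ _).trans hsub⟩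
  rw [hset, Finset.card_pair]
  · exact even_two
  · intro h
    have h1 := mem_tightSet.mp hvT
    have h2 := mem_tightSet.mp (h ▸ hvT)
    rw [LinearMap.add_apply, LinearMap.smul_apply, hqv, h1, smul_eq_mul] at h2
    linarith

include hp in
theorem exists_shelledComplex :
    ∃ S : ShelledComplex (finrank ℝ E) V, S.facets = facets p := by
  have hy : ∀ F : Finset V, ∃ y : Dual ℝ E, F ∈ facets p → (∀ v, y (p v) ≤ 1) ∧
      tightSet p y = F ∧ F.card = finrank ℝ E := by
    intro F
    by_cases hF : F ∈ facets p
    · obtain ⟨y, hy⟩ := mem_facets.mp hF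
      exact ⟨y, fun _ => hy⟩
    · exact ⟨0, fun h => absurd h hF⟩
  choose y hy using hy
  have hφ : ∀ F : Finset V, ∀ v : V, ∃ φ : Dual ℝ E, F ∈ facets p → v ∈ F →
      ∀ u ∈ F, φ (p u) = if u = v then 1 else 0 := by
    intro F v
    by_cases hF : F ∈ facets p
    · obtain ⟨h1, h2, _⟩ := hy F hF
      obtain ⟨φ, hφ⟩ := (hp.linearIndepOn _ h1).exists_dual_forall_eq
        fun u => if u = v then 1 else 0
      rw [h2] at hφ
      exact ⟨φ, fun _ _ => hφ⟩
    · exact ⟨0, fun h => absurd h hF⟩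
  choose φ hφ using hφ
  obtain ⟨u, hu⟩ := Module.Dual.exists_forall_ne_zero_of_forall_exists
    (ι := {x : Finset V × V // x.1 ∈ facets p ∧ x.2 ∈ x.1}) (fun x => φ x.1.1 x.1.2)
    fun x => ⟨p x.1.2, by rw [hφ _ _ x.2.1 x.2.2 _ x.2.2, if_pos rfl]; exact one_ne_zero⟩
  have hu' : ∀ F ∈ facets p, ∀ v ∈ F, φ F v u ≠ 0 := fun F hF v hv => hu ⟨(F, v), hF, hv⟩
  have hdiff : ∀ F ∈ facets p, ∀ F' ∈ facets p, y F' u - y F u =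
      ∑ v ∈ F, φ F v u * (y F' (p v) - 1) := by
    intro F hF F' hF'
    obtain ⟨h1, h2, h3⟩ := hy F hF
    have h4 : y F' - y F = ∑ v ∈ F, (y F' (p v) - 1) • φ F v := by
      refine hp.eq_of_eq_on_tightSet h1 (by rw [h2, h3]) fun w hw => ?_
      rw [LinearMap.sub_apply, mem_tightSet.mp hw, LinearMap.sum_apply]
      rw [h2] at hw
      rw [Finset.sum_eq_single_of_mem w hw]
      · rw [LinearMap.smul_apply, hφ F w hF hw w hw, if_pos rfl, smul_eq_mul, mul_one]
      · intro v hv hne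
        rw [LinearMap.smul_apply, hφ F v hF hv w hw, if_neg hne.symm, smul_zero]
    rw [← LinearMap.sub_apply, h4, LinearMap.sum_apply]
    exact Finset.sum_congr rfl fun v _ => by rw [LinearMap.smul_apply, smul_eq_mul, mul_comm]
  have hex : ∀ F ∈ facets p, ∀ F' ∈ facets p, F' ≠ F → ∃ v ∈ F, v ∉ F' := by
    intro F hF F' hF' hne
    by_contra! h
    exact hne (Finset.eq_of_subset_of_card_le h
      (by rw [(hy F hF).2.2, (hy F' hF').2.2])).symm
  have hle : ∀ F' ∈ facets p, ∀ v, y F' (p v) - 1 ≤ 0 := fun F' hF' v =>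
    sub_nonpos.mpr ((hy F' hF').1 v)
  have hlt : ∀ F' ∈ facets p, ∀ v ∉ F', y F' (p v) - 1 < 0 := by
    intro F' hF' v hv
    refine lt_of_le_of_ne (hle F' hF' v) fun h => hv ?_
    rw [← (hy F' hF').2.1, mem_tightSet]
    linarith
  have heq : ∀ F' ∈ facets p, ∀ v ∈ F', y F' (p v) - 1 = 0 := by
    intro F' hF' v hv
    rw [← (hy F' hF').2.1, mem_tightSet] at hv
    linarith
  refine ⟨⟨facets p, fun F => {v ∈ F | φ F v u < 0}, fun F => y F u,
    fun F hF => (hy F hF).2.2, hp.even_card_facets, fun F _ => Finset.filter_subset _ _,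
    fun F hF F' hF' hR hne => ?_, fun F hF F' hF' hR hne => ?_⟩, rfl⟩
  · obtain ⟨w, hw, hwF'⟩ := hex F hF F' hF' hne
    have hpos : ∀ v ∈ F, v ∉ F' → 0 < φ F v u := fun v hv hv' =>
      lt_of_le_of_ne (not_lt.mp fun h => hv' (hR (Finset.mem_filter.mpr ⟨hv, h⟩)))
        (hu' F hF v hv).symm
    rw [← sub_neg, hdiff F hF F' hF']
    refine Finset.sum_neg' (fun v hv => ?_) ⟨w, hw, ?_⟩
    · by_cases hv' : v ∈ F'
      · rw [heq F' hF' v hv', mul_zero]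
      · exact (mul_neg_of_pos_of_neg (hpos v hv hv') (hlt F' hF' v hv')).le
    · exact mul_neg_of_pos_of_neg (hpos w hw hwF') (hlt F' hF' w hwF')
  · obtain ⟨w, hw, hwF'⟩ := hex F hF F' hF' hne
    have hneg : ∀ v ∈ F, v ∉ F' → φ F v u < 0 := fun v hv hv' => by
      by_contra h
      exact hv' (hR (Finset.mem_sdiff.mpr ⟨hv, fun h' => h (Finset.mem_filter.mp h').2⟩))
    rw [← sub_pos, hdiff F hF F' hF']
    refine Finset.sum_pos' (fun v hv => ?_) ⟨w, hw, ?_⟩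
    · by_cases hv' : v ∈ F'
      · rw [heq F' hF' v hv', mul_zero]
      · exact (mul_pos_of_neg_of_neg (hneg v hv hv') (hlt F' hF' v hv')).le
    · exact mul_pos_of_neg_of_neg (hneg w hw hwF') (hlt F' hF' w hwF')

end IsSimplicialConfiguration

end

section

open Module

variable {d : ℕ} {P : Set (Fin d → ℝ)} {o : Fin d → ℝ}

theorem IsPolytope.convex (hpoly : IsPolytope P) : Convex ℝ P := by
  obtain ⟨V, rfl⟩ := hpoly
  exact convex_convexHull ℝ _

theorem IsPolytope.isCompact (hpoly : IsPolytope P) : IsCompact P := by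
  obtain ⟨V, rfl⟩ := hpoly
  exact V.finite_toSet.isCompact_convexHull ℝ

theorem IsPolytope.finite_extremePoints (hpoly : IsPolytope P) : (P.extremePoints ℝ).Finite := by
  obtain ⟨V, rfl⟩ := hpoly
  exact V.finite_toSet.subset extremePoints_convexHull_subset

theorem convexHull_extremePoints_of_finite {E : Type*} [NormedAddCommGroup E] [NormedSpace ℝ E]
    {s : Set E} (hc : IsCompact s) (hs : Convex ℝ s) (hf : (s.extremePoints ℝ).Finite) :
    convexHull ℝ (s.extremePoints ℝ) = s := by
  rw [← (hf.isCompact_convexHull ℝ).isClosed.closure_eq, closure_convexHull_extremePoints hc hs]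

theorem exists_pos_add_smul_mem {s : Set (Fin d → ℝ)} (ho : o ∈ interior s) (w : Fin d → ℝ) :
    ∃ ε : ℝ, 0 < ε ∧ o + ε • w ∈ s := by
  have hc : ContinuousAt (fun ε : ℝ => o + ε • w) 0 := by fun_prop
  have h : ∀ᶠ ε : ℝ in nhds 0, o + ε • w ∈ s :=
    hc.eventually (by simpa using mem_interior_iff_mem_nhds.mp ho)
  obtain ⟨ε, hε, hε0⟩ :=
    ((h.filter_mono nhdsWithin_le_nhds).and (self_mem_nhdsWithin (s := Ioi 0))).exists
  exact ⟨ε, hε0, hε⟩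

theorem exists_mem_lt_of_mem_interior (ho : o ∈ interior P) {q : Dual ℝ (Fin d → ℝ)}
    (hq : q ≠ 0) : ∃ x ∈ P, q o < q x := by
  obtain ⟨w, hw⟩ : ∃ w, q w ≠ 0 := by
    by_contra! h
    exact hq (LinearMap.ext h)
  obtain ⟨ε, hε, hmem⟩ := exists_pos_add_smul_mem ho (q w • w)
  refine ⟨_, hmem, ?_⟩
  have := mul_self_pos.mpr hw
  simp only [map_add, map_smul, smul_eq_mul]
  have := mul_pos hε this
  linarith

theorem IsPolytope.le_of_forall_extremePoints (hpoly : IsPolytope P) (q : Dual ℝ (Fin d → ℝ))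
    (c : ℝ) (h : ∀ v ∈ P.extremePoints ℝ, q v ≤ c) {x : Fin d → ℝ} (hx : x ∈ P) : q x ≤ c := by
  rw [← convexHull_extremePoints_of_finite hpoly.isCompact hpoly.convex
    hpoly.finite_extremePoints] at hx
  exact convexHull_min h (convex_halfSpace_le q.isLinear c) hx

/-- The part of `P` on which the functional `y`, normalised at `o`, attains the value `1`. -/
def dualFace (P : Set (Fin d → ℝ)) (o : Fin d → ℝ) (y : Dual ℝ (Fin d → ℝ)) :
    Set (Fin d → ℝ) :=
  {x ∈ P | y (x - o) = 1}

/-- The position of a vertex of `P` relative to `o`. -/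
def relVertex (P : Set (Fin d → ℝ)) (o : Fin d → ℝ) (v : P.extremePoints ℝ) : Fin d → ℝ := v - o

theorem IsPolytope.apply_sub_le (hpoly : IsPolytope P) {y : Dual ℝ (Fin d → ℝ)}
    (hy : ∀ v, y (relVertex P o v) ≤ 1) {x : Fin d → ℝ} (hx : x ∈ P) : y (x - o) ≤ 1 := by
  have := hpoly.le_of_forall_extremePoints y (1 + y o) (fun v hv => by
    have := hy ⟨v, hv⟩
    simp only [relVertex, map_sub] at this
    linarith) hx
  rw [map_sub]
  linarith

theorem IsPolytope.isExposed_dualFace (hpoly : IsPolytope P) {y : Dual ℝ (Fin d → ℝ)}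
    (hy : ∀ v, y (relVertex P o v) ≤ 1) : IsExposed ℝ P (dualFace P o y) := by
  rintro ⟨x₀, hx₀, hx₀'⟩
  refine ⟨y.toContinuousLinearMap, ?_⟩
  ext x
  simp only [dualFace, mem_ofPred_eq, LinearMap.coe_toContinuousLinearMap']
  refine and_congr_right fun hx => ⟨fun h z hz => ?_, fun h => ?_⟩
  · have := hpoly.apply_sub_le hy hz
    simp only [map_sub] at this h
    linarith
  · refine le_antisymm (hpoly.apply_sub_le hy hx) ?_
    have := h x₀ hx₀
    simp only [map_sub] at hx₀' ⊢
    linarith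

theorem IsPolytope.isProperFace_dualFace (hpoly : IsPolytope P) (ho : o ∈ P)
    {y : Dual ℝ (Fin d → ℝ)} (hy : ∀ v, y (relVertex P o v) ≤ 1)
    (hne : (dualFace P o y).Nonempty) : IsProperFace P (dualFace P o y) := by
  refine ⟨hne, fun h => ?_, hpoly.isExposed_dualFace hy⟩
  rw [← h] at ho
  simpa using ho.2

theorem IsProperFace.exists_eq_dualFace {F : Set (Fin d → ℝ)} (hF : IsProperFace P F)
    (ho : o ∈ interior P) :
    ∃ y : Dual ℝ (Fin d → ℝ), (∀ v, y (relVertex P o v) ≤ 1) ∧ F = dualFace P o y := by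
  obtain ⟨hne, hFP, hexp⟩ := hF
  obtain ⟨l, rfl⟩ := hexp hne
  obtain ⟨x₀, hx₀, hmax⟩ := hne
  have hl : l.toLinearMap ≠ 0 := by
    intro h0
    have h1 : ∀ x, l x = 0 := fun x => LinearMap.congr_fun h0 x
    exact hFP (Set.ext fun x => by simp [h1])
  obtain ⟨z, hz, hlt⟩ := exists_mem_lt_of_mem_interior ho hl
  have hpos : 0 < l x₀ - l o := sub_pos.mpr (hlt.trans_le (hmax z hz))
  refine ⟨(l x₀ - l o)⁻¹ • l.toLinearMap, fun v => ?_, ?_⟩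
  · have := hmax v v.2.1
    simp only [relVertex, LinearMap.smul_apply, smul_eq_mul, map_sub (l.toLinearMap),
      ContinuousLinearMap.coe_coe]
    rw [inv_mul_le_one₀ hpos]
    linarith
  · ext x
    simp only [dualFace, mem_ofPred_eq, LinearMap.smul_apply, smul_eq_mul, map_sub (l.toLinearMap),
      ContinuousLinearMap.coe_coe, inv_mul_eq_one₀ hpos.ne']
    refine and_congr_right fun hx => ⟨fun h => ?_, fun h y hy => ?_⟩
    · rw [le_antisymm (hmax x hx) (h x₀ hx₀)]
    · have := hmax y hy
      linarith

theorem IsPolytope.extremePoints_dualFace [Fintype (P.extremePoints ℝ)] (hpoly : IsPolytope P)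
    {y : Dual ℝ (Fin d → ℝ)} (hy : ∀ v, y (relVertex P o v) ≤ 1) :
    (dualFace P o y).extremePoints ℝ = 
      Subtype.val '' (tightSet (relVertex P o) y : Set (P.extremePoints ℝ)) := by
  rw [(hpoly.isExposed_dualFace hy).isExtreme.extremePoints_eq]
  ext x
  simp only [dualFace, relVertex, mem_inter_iff, mem_ofPred_eq, mem_image, Finset.mem_coe,
    mem_tightSet, Subtype.exists, exists_and_left, exists_prop, exists_eq_right_right]
  constructor
  · rintro ⟨⟨-, h1⟩, h2⟩
    exact ⟨h1, h2⟩
  · rintro ⟨h1, h2⟩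
    exact ⟨⟨h2.1, h1⟩, h2⟩

theorem IsPolytope.convexHull_tightSet [Fintype (P.extremePoints ℝ)] (hpoly : IsPolytope P)
    {y : Dual ℝ (Fin d → ℝ)} (hy : ∀ v, y (relVertex P o v) ≤ 1) :
    convexHull ℝ (Subtype.val '' (tightSet (relVertex P o) y : Set (P.extremePoints ℝ))) =
      dualFace P o y := by
  have hexp := hpoly.isExposed_dualFace hy
  rw [← hpoly.extremePoints_dualFace hy]
  refine convexHull_extremePoints_of_finite (hexp.isCompact hpoly.isCompact)
    (hexp.convex hpoly.convex) ?_
  rw [hpoly.extremePoints_dualFace hy]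
  exact (Finset.finite_toSet _).image _

theorem IsPolytope.isSimplicialConfiguration [Fintype (P.extremePoints ℝ)] (hpoly : IsPolytope P)
    (hs : IsSimplicial P) (ho : o ∈ interior P) :
    IsSimplicialConfiguration (relVertex P o) where
  exists_pos q hq := by
    by_contra! h
    obtain ⟨x, hx, hlt⟩ := exists_mem_lt_of_mem_interior ho hq
    have := hpoly.le_of_forall_extremePoints q (q o) (fun v hv => by
      have := h ⟨v, hv⟩
      simp only [relVertex, map_sub] at this
      linarith) hx
    linarith
  linearIndepOn y hy := by
    classical
    rcases (tightSet (relVertex P o) y).eq_empty_or_nonempty with hT | ⟨v₀, hv₀⟩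
    · simp [hT]
    have hF := hpoly.isProperFace_dualFace (interior_subset ho) hy
      ⟨v₀, v₀.2.1, (mem_tightSet (p := relVertex P o)).mp hv₀⟩
    have hind := hs _ hF
    have hext := hpoly.extremePoints_dualFace hy
    let e : (tightSet (relVertex P o) y : Set (P.extremePoints ℝ)) ↪
        (dualFace P o y).extremePoints ℝ :=
      ⟨fun v => ⟨v.1.1, hext ▸ mem_image_of_mem _ v.2⟩, fun v w h => by
        exact Subtype.ext (Subtype.ext (Subtype.mk.inj h))⟩
    have hind' : AffineIndependent ℝ
        fun v : (tightSet (relVertex P o) y : Set (P.extremePoints ℝ)) => (v.1.1 : Fin d → ℝ) :=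
      hind.comp_embedding e
    rw [LinearIndepOn, linearIndependent_iff']
    intro s c hc
    have h1 : ∑ v ∈ s, c v = 0 := by
      have := congrArg y hc
      rw [map_sum, map_zero] at this
      rw [← this]
      refine Finset.sum_congr rfl fun v _ => ?_
      rw [map_smul, mem_tightSet.mp v.2, smul_eq_mul, mul_one]
    refine affineIndependent_iff.mp hind' s c h1 ?_
    simp only [relVertex, smul_sub, Finset.sum_sub_distrib, ← Finset.sum_smul, h1, zero_smul,
      sub_zero] at hc
    exact hc

theorem IsSimplicial.finrank_direction_dualFace [Fintype (P.extremePoints ℝ)]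
    (hs : IsSimplicial P) (hpoly : IsPolytope P) (ho : o ∈ P)
    {y : Dual ℝ (Fin d → ℝ)} (hy : ∀ v, y (relVertex P o v) ≤ 1)
    (hne : (dualFace P o y).Nonempty) :
    finrank ℝ (affineSpan ℝ (dualFace P o y)).direction + 1 =
      (tightSet (relVertex P o) y).card := by
  classical
  have hind := hs _ (hpoly.isProperFace_dualFace ho hy hne)
  have hext := hpoly.extremePoints_dualFace hy
  rw [← hpoly.convexHull_tightSet hy] at hne ⊢
  rw [convexHull_nonempty_iff, image_nonempty, Finset.coe_nonempty] at hne
  have hc := Nat.sub_add_cancel hne.card_pos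
  rw [hext] at hind
  have := hind.finrank_vectorSpan (n := (tightSet (relVertex P o) y).card - 1) (by
    rw [hc, ← Nat.card_eq_fintype_card, Nat.card_coe_set_eq,
      ncard_image_of_injective _ Subtype.val_injective, ncard_coe_finset])
  rw [affineSpan_convexHull, direction_affineSpan, ← hc]
  rw [Subtype.range_coe] at this
  rw [this]

theorem faceCount_eq_card_faces [Fintype (P.extremePoints ℝ)] [DecidableEq (P.extremePoints ℝ)]
    (hpoly : IsPolytope P) (hs : IsSimplicial P) (ho : o ∈ interior P) {n : ℕ}
    {S : ShelledComplex n (P.extremePoints ℝ)}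
    (hS : S.facets = IsSimplicialConfiguration.facets (relVertex P o)) (j : ℕ) :
    faceCount P j = (S.faces (j + 1)).card := by
  have hconf := hpoly.isSimplicialConfiguration hs ho
  have hfaces : ∀ U, U ∈ S.faces (j + 1) ↔ (∃ y : Dual ℝ (Fin d → ℝ),
      (∀ v, y (relVertex P o v) ≤ 1) ∧ tightSet (relVertex P o) y = U) ∧ U.card = j + 1 := by
    intro U
    rw [← hconf.exists_mem_facets_iff, ← hS]
    simp only [ShelledComplex.faces, Finset.mem_biUnion, Finset.mem_powersetCard]
    grind
  have himage : {F : Set (Fin d → ℝ) |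
      IsProperFace P F ∧ finrank ℝ (affineSpan ℝ F).direction = j} =
      (fun U : Finset (P.extremePoints ℝ) =>
        convexHull ℝ (Subtype.val '' (U : Set (P.extremePoints ℝ)))) ''
        (S.faces (j + 1) : Set (Finset (P.extremePoints ℝ))) := by
    ext F
    simp only [mem_ofPred_eq, mem_image, Finset.mem_coe, hfaces]
    constructor
    · rintro ⟨hF, hdim⟩
      obtain ⟨y, hy, rfl⟩ := hF.exists_eq_dualFace ho
      refine ⟨_, ⟨⟨y, hy, rfl⟩, ?_⟩, hpoly.convexHull_tightSet hy⟩
      rw [← hs.finrank_direction_dualFace hpoly (interior_subset ho) hy hF.1, hdim]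
    · rintro ⟨U, ⟨⟨y, hy, rfl⟩, hcard⟩, rfl⟩
      rw [hpoly.convexHull_tightSet hy]
      have hne : (dualFace P o y).Nonempty := by
        obtain ⟨v, hv⟩ := Finset.card_pos.mp (j.succ_pos.trans_eq hcard.symm)
        exact ⟨v, v.2.1, (mem_tightSet (p := relVertex P o)).mp hv⟩
      have := hs.finrank_direction_dualFace hpoly (interior_subset ho) hy hne
      exact ⟨hpoly.isProperFace_dualFace (interior_subset ho) hy hne, by omega⟩
  rw [faceCount, himage, InjOn.ncard_image, ncard_coe_finset]
  intro U hU W hW h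
  obtain ⟨⟨y, hy, rfl⟩, -⟩ := (hfaces U).mp hU
  obtain ⟨⟨z, hz, rfl⟩, -⟩ := (hfaces W).mp hW
  have h : dualFace P o y = dualFace P o z := by
    rw [← hpoly.convexHull_tightSet hy, ← hpoly.convexHull_tightSet hz]
    exact h
  have h1 := congrArg (extremePoints ℝ) h
  rw [hpoly.extremePoints_dualFace hy, hpoly.extremePoints_dualFace hz] at h1
  exact Finset.coe_injective (image_injective.mpr Subtype.val_injective h1)

theorem fm_eq_card_faces [Fintype (P.extremePoints ℝ)] [DecidableEq (P.extremePoints ℝ)]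
    (hpoly : IsPolytope P) (hs : IsSimplicial P) (ho : o ∈ interior P) {n : ℕ}
    {S : ShelledComplex n (P.extremePoints ℝ)}
    (hS : S.facets = IsSimplicialConfiguration.facets (relVertex P o)) (j : ℕ) :
    fm P j = (S.faces j).card := by
  rcases j with _ | j
  · have hconf := hpoly.isSimplicialConfiguration hs ho
    have hex : ∃ F ∈ S.facets, (tightSet (relVertex P o) 0) ⊆ F := by
      rw [hS, hconf.exists_mem_facets_iff]
      exact ⟨0, by simp, rfl⟩
    have : S.faces 0 = {∅} := by
      ext U
      obtain ⟨F, hF, -⟩ := hex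
      simp only [ShelledComplex.faces, Finset.mem_biUnion, Finset.mem_powersetCard,
        Finset.card_eq_zero, Finset.mem_singleton]
      exact ⟨fun ⟨_, _, _, h⟩ => h, fun h => ⟨F, hF, h ▸ Finset.empty_subset F, h⟩⟩
    simp [fm, this]
  · simp [fm, faceCount_eq_card_faces hpoly hs ho hS]

end

/-- The inequality part of the Generalized Lower Bound Theorem:
the `h`-vector of a simplicial `d`-polytope is nondecreasing up to the middle. -/
theorem stmt16 {d : ℕ} (P : Set (Fin d → ℝ))
    (hpoly : IsPolytope P) (hfull : affineSpan ℝ P = ⊤) (hsimp : IsSimplicial P) :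
    hP P 0 = 1 ∧ ∀ i : ℕ, 1 ≤ i → i ≤ d / 2 → hP P (i - 1) ≤ hP P i := by
  classical
  refine ⟨by simp [hP, fm], fun i hi hid => ?_⟩
  obtain ⟨o, ho⟩ : (interior P).Nonempty := by
    obtain ⟨V, rfl⟩ := hpoly
    rw [affineSpan_convexHull] at hfull
    exact interior_convexHull_nonempty_iff_affineSpan_eq_top.mpr hfull
  have : Fintype (P.extremePoints ℝ) := hpoly.finite_extremePoints.fintype
  have hS := (hpoly.isSimplicialConfiguration hsimp ho).exists_shelledComplex
  rw [Module.finrank_fin_fun] at hS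
  obtain ⟨S, hS⟩ := hS
  have key : ∀ k ≤ d, hP P k = {F ∈ S.facets | (S.R F).card = k}.card := by
    intro k hk
    rw [← S.sum_neg_one_pow_mul_card_faces hk, hP]
    simp only [fm_eq_card_faces hpoly hsimp ho hS]
  rw [key _ (by omega), key _ (by omega), Nat.cast_le]
  obtain ⟨k, rfl⟩ := Nat.exists_eq_add_of_le' hi
  exact S.card_le_card_succ (by omega)
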